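/- Let k be an algebraically closed field of characteristic 0, q ∈ k^× and G ∈ ℕ with G ≥ 1. In the free algebra k⟨x_1,x_2,x_3⟩ define x_21 := x_2x_1 + x_1x_2, z_0 := x_3 and z_{t+1} := x_2·z_t − (−1)^t·q·z_t·x_2 for t ≥ 0. Let A be the quotient of k⟨x_1,x_2,x_3⟩ by the two-sided ideal generated by: x_1², x_2x_21 − x_21x_2 − x_1x_21, x_1x_3 − q·x_3x_1, x_21x_3 − q²·x_3x_21, z_{2G+1}, z_{2k}² for 0 ≤ k ≤ G, and z_{2k−1}·z_{2k} + q^{−1}·z_{2k}·z_{2k−1} for 1 ≤ k ≤ G. Then the images of the monomials x_1^{m_1}·x_21^{m_2}·x_2^{m_3}·z_{2G}^{n_{2G}}·⋯·z_1^{n_1}·z_0^{n_0}, with m_1 ∈ {0,1}, n_{2k} ∈ {0,1}, and m_2, m_3, n_{2k−1} ∈ ℕ, form a k-basis of A, and GKdim A = G + 2. (A is the Nichols algebra B(lstr_−(−1,G)) of a super Jordan block, a point with label −1, weak interaction and discrete ghost G.) -/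

import Mathlib

open scoped ENNReal

/-- The Gelfand–Kirillov dimension of a `k`-algebra `A`. -/
noncomputable def GKdim (k A : Type*) [Field k] [Ring A] [Algebra k A] : ℝ≥0∞ :=
  ⨆ (V : Submodule k A) (_ : FiniteDimensional k V),
    Filter.limsup
      (fun n : ℕ =>
        ENNReal.ofReal
          (Real.log ((Module.finrank k (↥(∑ j ∈ Finset.range (n + 1), V ^ j)) : ℕ) : ℝ) /
            Real.log (n : ℝ)))
      Filter.atTop

/-- The generator `x_{i+1}` of the free algebra `k⟨x₁,x₂,x₃⟩`. -/
noncomputable def X (k : Type*) [Field k] (i : Fin 3) : FreeAlgebra k (Fin 3) :=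
  FreeAlgebra.ι k i

/-- `x₂₁ := x₂x₁ + x₁x₂`. -/
noncomputable def x21 (k : Type*) [Field k] : FreeAlgebra k (Fin 3) :=
  X k 1 * X k 0 + X k 0 * X k 1

/-- `z₀ := x₃`, `z_{t+1} := x₂ z_t − (−1)^t q z_t x₂`. -/
noncomputable def z (k : Type*) [Field k] (q : k) : ℕ → FreeAlgebra k (Fin 3)
  | 0 => X k 2
  | (t + 1) => X k 1 * z k q t - ((-1 : k) ^ t * q) • (z k q t * X k 1)

/-- The defining relations of `B(lstr₋(−1,G))`. -/
def lstrRel (k : Type*) [Field k] (q : k) (G : ℕ)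
    (a b : FreeAlgebra k (Fin 3)) : Prop :=
  b = 0 ∧
    (a = X k 0 * X k 0 ∨
     a = X k 1 * x21 k - x21 k * X k 1 - X k 0 * x21 k ∨
     a = X k 0 * X k 2 - q • (X k 2 * X k 0) ∨
     a = x21 k * X k 2 - (q ^ 2) • (X k 2 * x21 k) ∨
     a = z k q (2 * G + 1) ∨
     (∃ j ≤ G, a = z k q (2 * j) * z k q (2 * j)) ∨
     (∃ j : ℕ, 1 ≤ j ∧ j ≤ G ∧ a = z k q (2 * j - 1) * z k q (2 * j) +
        q⁻¹ • (z k q (2 * j) * z k q (2 * j - 1))))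

/-- The PBW monomials `x₁^{m₁} x₂₁^{m₂} x₂^{m₃} z_{2G}^{n_{2G}} ⋯ z₀^{n₀}`, where
`m₁ ∈ {0,1}` and the exponents of the even-indexed `z`'s lie in `{0,1}`. -/
noncomputable def bas (k : Type*) [Field k] (q : k) (G : ℕ)
    (p : Fin 2 × ℕ × ℕ ×
      {n : Fin (2 * G + 1) → ℕ // ∀ t : Fin (2 * G + 1), (t : ℕ) % 2 = 0 → n t ≤ 1}) :
    RingQuot (lstrRel k q G) :=
  RingQuot.mkAlgHom k (lstrRel k q G)
    (X k 0 ^ ((p.1 : ℕ)) * x21 k ^ p.2.1 * X k 1 ^ p.2.2.1 *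
      ((List.ofFn fun t : Fin (2 * G + 1) => z k q (t : ℕ) ^ p.2.2.2.1 t).reverse).prod)

/-- The relations of `lstrRel`, for a tuple of elements of an algebra. -/
structure IsLstr {k A : Type*} [Field k] [Ring A] [Algebra k A] (q : k) (G : ℕ)
    (x₁ x₂ y : A) (Z : ℕ → A) : Prop where
  sq : x₁ * x₁ = 0
  y_eq : y = x₂ * x₁ + x₁ * x₂
  x₂_y : x₂ * y = y * x₂ + x₁ * y
  succ : ∀ t, Z (t + 1) = x₂ * Z t - ((-1 : k) ^ t * q) • (Z t * x₂)
  x₁_zero : x₁ * Z 0 = q • (Z 0 * x₁)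
  y_zero : y * Z 0 = q ^ 2 • (Z 0 * y)
  top : Z (2 * G + 1) = 0
  even_sq : ∀ j ≤ G, Z (2 * j) * Z (2 * j) = 0
  adj : ∀ j, 1 ≤ j → j ≤ G →
    Z (2 * j - 1) * Z (2 * j) + q⁻¹ • (Z (2 * j) * Z (2 * j - 1)) = 0

/-- The ordered monomial `Z_{m-1}^{n_{m-1}} ⋯ Z_0^{n_0}`. -/
def zMon {A : Type*} [Monoid A] (Z : ℕ → A) : ℕ → (ℕ → ℕ) → A
  | 0, _ => 1
  | m + 1, n => Z m ^ n m * zMon Z m n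

section zMon

theorem zMon_congr {A : Type*} [Monoid A] (Z : ℕ → A) {m : ℕ} {n n' : ℕ → ℕ}
    (h : ∀ t < m, n t = n' t) : zMon Z m n = zMon Z m n' := by
  induction m with
  | zero => rfl
  | succ m ih =>
    simp only [zMon]
    rw [h m (by omega), ih fun t ht => h t (by omega)]

theorem reverse_ofFn_prod {A : Type*} [Monoid A] (Z : ℕ → A) (m : ℕ) (n : ℕ → ℕ) :
    ((List.ofFn fun t : Fin m => Z (t : ℕ) ^ n t).reverse).prod = zMon Z m n := by
  induction m with
  | zero => simp [zMon]
  | succ m ih =>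
    rw [List.ofFn_succ']
    simp [zMon, ih]

theorem zMon_eq_zero {A : Type*} [Ring A] (Z : ℕ → A) {t m : ℕ} (ht : t < m)
    (hZ : Z t * Z t = 0) {n : ℕ → ℕ} (hn : 2 ≤ n t) : zMon Z m n = 0 := by
  induction m with
  | zero => omega
  | succ m ih =>
    simp only [zMon]
    rcases Nat.lt_succ_iff_lt_or_eq.mp ht with h | rfl
    · rw [ih h, mul_zero]
    · obtain ⟨j, hj⟩ := Nat.exists_eq_add_of_le hn
      rw [hj, pow_add, pow_two, hZ, zero_mul, zero_mul]

theorem exists_mul_zMon {k A : Type*} [Field k] [Ring A] [Algebra k A] (Z : ℕ → A)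
    (hZ : ∀ s t, s ≤ t → ∃ c : k, Z s * Z t = c • (Z t * Z s)) {t m : ℕ} (ht : t < m)
    (n : ℕ → ℕ) : ∃ c : k, Z t * zMon Z m n = c • zMon Z m (n + Pi.single t 1) := by
  induction m with
  | zero => omega
  | succ m ih =>
    simp only [zMon]
    rcases Nat.lt_succ_iff_lt_or_eq.mp ht with h | rfl
    · obtain ⟨c, hc⟩ := ih h
      obtain ⟨d, hd⟩ := hZ t m h.le
      have hpow : ∀ j : ℕ, Z t * Z m ^ j = d ^ j • (Z m ^ j * Z t) := by
        intro j
        induction j with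
        | zero => simp
        | succ j ihj =>
          rw [pow_succ, ← mul_assoc, ihj, smul_mul_assoc, mul_assoc, hd, mul_smul_comm, smul_smul,
            ← mul_assoc, pow_succ d]
      refine ⟨d ^ n m * c, ?_⟩
      have h1 : (n + Pi.single t 1 : ℕ → ℕ) m = n m := by simp [h.ne']
      rw [h1, ← mul_assoc, hpow, smul_mul_assoc, mul_assoc, hc, mul_smul_comm, smul_smul]
    · refine ⟨1, ?_⟩
      have h1 : (n + Pi.single t 1 : ℕ → ℕ) t = n t + 1 := by simp
      rw [h1, one_smul, pow_succ', mul_assoc]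
      congr 2
      refine zMon_congr Z fun s hs => ?_
      simp [hs.ne]

end zMon

namespace IsLstr

variable {k A : Type*} [Field k] [Ring A] [Algebra k A] {q : k} {G : ℕ}
  {x₁ x₂ y : A} {Z : ℕ → A}

theorem x₁_y (h : IsLstr q G x₁ x₂ y Z) : x₁ * y = y * x₁ := by
  rw [h.y_eq, mul_add, add_mul, ← mul_assoc x₁ x₁, h.sq, mul_assoc x₂, h.sq, mul_assoc]
  simp

theorem x₁_Z_and_y_Z (h : IsLstr q G x₁ x₂ y Z) (t : ℕ) :
    x₁ * Z t = ((-1) ^ t * q) • (Z t * x₁) ∧ y * Z t = q ^ 2 • (Z t * y) := by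
  induction t with
  | zero => simpa using ⟨h.x₁_zero, h.y_zero⟩
  | succ t ih =>
    obtain ⟨h1, h2⟩ := ih
    have hs : ((-1 : k) ^ t) * (-1) ^ t = 1 := by rw [← mul_pow]; simp
    have e1 : x₁ * (x₂ * Z t) = y * Z t - x₂ * (x₁ * Z t) := by
      rw [h.y_eq]; noncomm_ring
    have e2 : x₁ * (Z t * x₂) = ((-1) ^ t * q) • (Z t * (x₁ * x₂)) := by
      rw [← mul_assoc, h1, smul_mul_assoc, mul_assoc]
    have e3 : y * (x₂ * Z t) = x₂ * (y * Z t) - x₁ * (y * Z t) := by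
      have := congrArg (· * Z t) h.x₂_y
      simp only [add_mul, mul_assoc] at this
      rw [this]; abel
    have e4 : y * (Z t * x₂) = q ^ 2 • (Z t * (y * x₂)) := by
      rw [← mul_assoc, h2, smul_mul_assoc, mul_assoc]
    have e5 : Z t * (x₂ * y) = Z t * (y * x₂) + Z t * (x₁ * y) := by rw [h.x₂_y, mul_add]
    have e6 : x₁ * (Z t * y) = ((-1) ^ t * q) • (Z t * (x₁ * y)) := by
      rw [← mul_assoc, h1, smul_mul_assoc, mul_assoc]
    constructor
    · rw [h.succ, mul_sub, mul_smul_comm, e1, e2, h2, h1, h.y_eq]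
      simp only [mul_add, sub_mul, mul_smul_comm, smul_mul_assoc, mul_assoc, smul_smul, pow_succ]
      match_scalars <;> first | ring1 | linear_combination (-(q ^ 2)) * hs
    · rw [h.succ, mul_sub, mul_smul_comm, e3, e4, h2]
      simp only [sub_mul, mul_smul_comm, smul_mul_assoc, mul_assoc, e5, e6]
      module

theorem Z_eq_zero (h : IsLstr q G x₁ x₂ y Z) {t : ℕ} (ht : 2 * G < t) : Z t = 0 := by
  induction t, ht using Nat.le_induction with
  | base => exact h.top
  | succ t _ ih => rw [h.succ, ih]; simp

theorem even_mul_self (h : IsLstr q G x₁ x₂ y Z) (j : ℕ) : Z (2 * j) * Z (2 * j) = 0 := by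
  rcases le_or_gt j G with hj | hj
  · exact h.even_sq j hj
  · rw [h.Z_eq_zero (by omega), zero_mul]

theorem x₂_Z (h : IsLstr q G x₁ x₂ y Z) (t : ℕ) :
    x₂ * Z t = Z (t + 1) + ((-1 : k) ^ t * q) • (Z t * x₂) := by
  rw [h.succ]; abel

theorem x₂_mul (h : IsLstr q G x₁ x₂ y Z) (s t : ℕ) :
    x₂ * (Z s * Z t) = Z (s + 1) * Z t + ((-1 : k) ^ s * q) • (Z s * Z (t + 1))
      + ((-1 : k) ^ (s + t) * q ^ 2) • (Z s * Z t * x₂) := by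
  rw [← mul_assoc, h.x₂_Z, add_mul, smul_mul_assoc, mul_assoc (Z s) x₂, h.x₂_Z, mul_add,
    mul_smul_comm, smul_add, smul_smul, mul_assoc, add_assoc]
  rw [mul_assoc (Z s)]
  congr 3
  ring

theorem qcomm_step (h : IsLstr q G x₁ x₂ y Z) {s t : ℕ} {e : k}
    (h0 : Z s * Z t = e • (Z t * Z s)) :
    Z (s + 1) * Z t + ((-1 : k) ^ s * q) • (Z s * Z (t + 1)) =
      e • (Z (t + 1) * Z s + ((-1 : k) ^ t * q) • (Z t * Z (s + 1))) := by
  have := congrArg (x₂ * ·) h0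
  simp only [mul_smul_comm, h.x₂_mul] at this
  rw [h0, add_comm t s] at this
  simp only [smul_mul_assoc] at this
  have e : ∀ a b c : A, a + c = b + c → a = b := fun a b c h => add_right_cancel h
  refine e _ _ _ (this.trans ?_)
  module

theorem qcomm_aux [CharZero k] (hq : q ≠ 0) (h : IsLstr q G x₁ x₂ y Z) (d : ℕ) :
    (∀ t, Z t * Z (t + d) = ((-1 : k) ^ (t * (t + d) + 1) * q⁻¹ ^ d) • (Z (t + d) * Z t)) ∧
    (∀ t, Z t * Z (t + (d + 1)) =
      ((-1 : k) ^ (t * (t + (d + 1)) + 1) * q⁻¹ ^ (d + 1)) • (Z (t + (d + 1)) * Z t)) := by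
  induction d with
  | zero =>
    constructor
    · intro t
      rcases Nat.even_or_odd' t with ⟨j, rfl | rfl⟩
      · simp [h.even_mul_self]
      · have : Odd ((2 * j + 1) * (2 * j + 1)) := by
          exact Odd.mul ⟨j, rfl⟩ ⟨j, rfl⟩
        simp [this.neg_one_pow, pow_succ (-1 : k) ((2 * j + 1) * (2 * j + 1))]
    · intro t
      have hev : Even (t * (t + 1)) := Nat.even_mul_succ_self t
      simp only [zero_add, pow_succ _ (t * (t + 1)), hev.neg_one_pow, pow_one]
      rcases Nat.even_or_odd' t with ⟨j, rfl | rfl⟩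
      · have h0 : Z (2 * j) * Z (2 * j) = (1 : k) • (Z (2 * j) * Z (2 * j)) := by simp
        have h1 := h.x₂_mul (2 * j) (2 * j)
        rw [h.even_mul_self, mul_zero, zero_mul, smul_zero, add_zero] at h1
        replace h1 := h1.symm
        simp only [even_two, Even.mul_right, Even.neg_pow, one_pow, one_mul] at h1
        have h2 : Z (2 * j) * Z (2 * j + 1) =
            q⁻¹ • (q • (Z (2 * j) * Z (2 * j + 1))) := by
          rw [smul_smul, inv_mul_cancel₀ hq, one_smul]
        rw [h2, eq_neg_of_add_eq_zero_right h1]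
        module
      · rcases le_or_gt (j + 1) G with hj | hj
        · have h1 := h.adj (j + 1) (by omega) hj
          have e1 : 2 * (j + 1) - 1 = 2 * j + 1 := by omega
          have e2 : 2 * (j + 1) = 2 * j + 1 + 1 := by omega
          rw [e1, e2] at h1
          rw [eq_neg_of_add_eq_zero_left h1]
          module
        · rw [h.Z_eq_zero (t := 2 * j + 1 + 1) (by omega)]
          simp
  | succ d ih =>
    refine ⟨ih.2, fun t => ?_⟩
    have h1 := h.qcomm_step (ih.2 t)
    have h2 := ih.1 (t + 1)
    have e1 : t + 1 + d = t + (d + 1) := by ring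
    rw [e1] at h2
    have e2 : t + (d + 1) + 1 = t + (d + 1 + 1) := by ring
    rw [h2, e2] at h1
    have hs : ((-1 : k) ^ t) * (-1) ^ t = 1 := by rw [← mul_pow]; simp
    have hd : ((-1 : k) ^ d) * (-1) ^ d = 1 := by rw [← mul_pow]; simp
    have hi : q * q⁻¹ = 1 := mul_inv_cancel₀ hq
    have h3 : Z t * Z (t + (d + 1 + 1)) = ((-1 : k) ^ t * q⁻¹) •
        (((-1 : k) ^ t * q) • (Z t * Z (t + (d + 1 + 1)))) := by
      rw [smul_smul]
      rw [show (-1 : k) ^ t * q⁻¹ * ((-1) ^ t * q) = ((-1) ^ t * (-1) ^ t) * (q * q⁻¹) by ring,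
        hs, hi, one_mul, one_smul]
    rw [h3, eq_sub_of_add_eq' h1]
    have p1 : (-1 : k) ^ ((t + 1) * (t + (d + 1)) + 1) =
        (-1) ^ (t * (t + (d + 1)) + 1) * ((-1) ^ t * (-1) ^ d * (-1)) := by
      rw [← pow_add, ← pow_succ, ← pow_add]; congr 1; ring
    have p2 : (-1 : k) ^ (t * (t + (d + 1 + 1)) + 1) =
        (-1) ^ (t * (t + (d + 1)) + 1) * (-1) ^ t := by
      rw [← pow_add]; congr 1; ring
    have p3 : (-1 : k) ^ (t + (d + 1)) = (-1) ^ t * (-1) ^ d * (-1) := by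
      rw [← pow_add, ← pow_succ]; congr 1
    rw [p1, p2, p3]
    generalize (-1 : k) ^ (t * (t + (d + 1)) + 1) = u
    generalize (-1 : k) ^ t = v at *
    generalize (-1 : k) ^ d = w at *
    match_scalars
    · ring
    · have : q⁻¹ ^ (d + 1) * q = q⁻¹ ^ d := by
        rw [pow_succ, mul_assoc, mul_comm q⁻¹, hi, mul_one]
      linear_combination (-v * q⁻¹ * u * v * w) * this

theorem qcomm [CharZero k] (hq : q ≠ 0) (h : IsLstr q G x₁ x₂ y Z) (s t : ℕ) (hst : s ≤ t) :
    ∃ c : k, Z s * Z t = c • (Z t * Z s) := by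
  obtain ⟨d, rfl⟩ := Nat.exists_eq_add_of_le hst
  exact ⟨_, (h.qcomm_aux hq d).1 s⟩

end IsLstr

/-- The span of the PBW monomials in `x₁, y, x₂, Z_t` with at most `N` factors. -/
def pbwFilt (k : Type*) {A : Type*} [Field k] [Ring A] [Algebra k A] (G : ℕ)
    (x₁ x₂ y : A) (Z : ℕ → A) (N : ℕ) : Submodule k A :=
  Submodule.span k {a | ∃ (i b c : ℕ) (n : ℕ → ℕ), i ≤ 1 ∧ (∀ t, Even t → n t ≤ 1) ∧
    i + b + c + ∑ t ∈ Finset.range (2 * G + 1), n t ≤ N ∧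
    a = x₁ ^ i * y ^ b * x₂ ^ c * zMon Z (2 * G + 1) n}

namespace IsLstr

variable {k A : Type*} [Field k] [Ring A] [Algebra k A] {q : k} {G : ℕ}
  {x₁ x₂ y : A} {Z : ℕ → A}

theorem mon_mem_pbwFilt {i b c N : ℕ} {n : ℕ → ℕ} (hi : i ≤ 1) (hn : ∀ t, Even t → n t ≤ 1)
    (h : i + b + c + ∑ t ∈ Finset.range (2 * G + 1), n t ≤ N) :
    x₁ ^ i * y ^ b * x₂ ^ c * zMon Z (2 * G + 1) n ∈ pbwFilt k G x₁ x₂ y Z N :=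
  Submodule.subset_span ⟨i, b, c, n, hi, hn, h, rfl⟩

theorem pbwFilt_mono : Monotone (pbwFilt k G x₁ x₂ y Z) := by
  intro N M hNM
  refine Submodule.span_mono ?_
  rintro _ ⟨i, b, c, n, hi, hn, h, rfl⟩
  exact ⟨i, b, c, n, hi, hn, h.trans hNM, rfl⟩

theorem one_mem_pbwFilt (N : ℕ) : (1 : A) ∈ pbwFilt k G x₁ x₂ y Z N := by
  have h0 : ∀ m, zMon Z m (fun _ => 0) = 1 := by
    intro m
    induction m with
    | zero => rfl
    | succ m ih => simp [zMon, ih]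
  have := mon_mem_pbwFilt (k := k) (x₁ := x₁) (x₂ := x₂) (y := y) (Z := Z) (G := G) (N := N)
    (i := 0) (b := 0) (c := 0) (n := fun _ => 0) (by simp) (by simp) (by simp)
  simpa [h0] using this

theorem mul_mem_of_mon (a : A) {M : ℕ}
    (h : ∀ (i b c : ℕ) (n : ℕ → ℕ), i ≤ 1 → (∀ t, Even t → n t ≤ 1) →
      a * (x₁ ^ i * y ^ b * x₂ ^ c * zMon Z (2 * G + 1) n) ∈
        pbwFilt k G x₁ x₂ y Z (i + b + c + ∑ t ∈ Finset.range (2 * G + 1), n t + M))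
    {N : ℕ} {w : A} (hw : w ∈ pbwFilt k G x₁ x₂ y Z N) :
    a * w ∈ pbwFilt k G x₁ x₂ y Z (N + M) := by
  have : pbwFilt k G x₁ x₂ y Z N ≤
      (pbwFilt k G x₁ x₂ y Z (N + M)).comap (LinearMap.mulLeft k a) := by
    refine Submodule.span_le.mpr ?_
    rintro _ ⟨i, b, c, n, hi, hn, hN, rfl⟩
    exact pbwFilt_mono (by omega) (h i b c n hi hn)
  exact this hw

theorem x₁_mul_mem (h : IsLstr q G x₁ x₂ y Z) {N : ℕ} {w : A}
    (hw : w ∈ pbwFilt k G x₁ x₂ y Z N) : x₁ * w ∈ pbwFilt k G x₁ x₂ y Z (N + 1) := by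
  refine mul_mem_of_mon _ (fun i b c n hi hn => ?_) hw
  interval_cases i
  · have := mon_mem_pbwFilt (k := k) (x₁ := x₁) (x₂ := x₂) (y := y) (Z := Z) (G := G)
      (b := b) (c := c) le_rfl hn le_rfl
    simp only [mul_assoc, pow_one, pow_zero, one_mul] at this ⊢
    exact pbwFilt_mono (by omega) this
  · simp only [mul_assoc, pow_one]
    rw [← mul_assoc, h.sq, zero_mul]
    exact zero_mem _

theorem y_mul_mem (h : IsLstr q G x₁ x₂ y Z) {N : ℕ} {w : A}
    (hw : w ∈ pbwFilt k G x₁ x₂ y Z N) : y * w ∈ pbwFilt k G x₁ x₂ y Z (N + 1) := by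
  refine mul_mem_of_mon _ (fun i b c n hi hn => ?_) hw
  have h1 : y * x₁ ^ i = x₁ ^ i * y := (Commute.pow_right (h.x₁_y).symm i)
  have := mon_mem_pbwFilt (k := k) (x₁ := x₁) (x₂ := x₂) (y := y) (Z := Z) (G := G)
      (b := b + 1) (c := c) hi hn le_rfl
  simp only [← mul_assoc, h1]
  rw [mul_assoc (x₁ ^ i) y, ← pow_succ']
  exact pbwFilt_mono (by omega) this

theorem x₂_y_pow (h : IsLstr q G x₁ x₂ y Z) (b : ℕ) :
    x₂ * y ^ b = y ^ b * x₂ + (b : k) • (x₁ * y ^ b) := by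
  induction b with
  | zero => simp
  | succ b ih =>
    have h1 : y ^ b * x₁ = x₁ * y ^ b := (Commute.pow_right (h.x₁_y) b).symm
    rw [pow_succ, ← mul_assoc, ih, add_mul, mul_assoc, h.x₂_y, smul_mul_assoc, mul_add,
      ← mul_assoc (y ^ b) x₁, h1]
    simp only [mul_assoc]
    push_cast
    module

theorem x₂_mul_mem (h : IsLstr q G x₁ x₂ y Z) {N : ℕ} {w : A}
    (hw : w ∈ pbwFilt k G x₁ x₂ y Z N) : x₂ * w ∈ pbwFilt k G x₁ x₂ y Z (N + 1) := by
  refine mul_mem_of_mon _ (fun i b c n hi hn => ?_) hw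
  set S := ∑ t ∈ Finset.range (2 * G + 1), n t
  have e0 : ∀ u, x₂ * (y ^ b * u) = y ^ b * (x₂ * u) + (b : k) • (x₁ * (y ^ b * u)) := by
    intro u
    rw [← mul_assoc, h.x₂_y_pow, add_mul, smul_mul_assoc, mul_assoc, mul_assoc]
  have k0 := mon_mem_pbwFilt (k := k) (x₁ := x₁) (x₂ := x₂) (y := y) (Z := Z) (G := G)
    (i := 0) (b := b) (c := c + 1) (n := n) (N := i + b + c + S + 1) (by omega) hn (by omega)
  interval_cases i
  · have k1 := mon_mem_pbwFilt (k := k) (x₁ := x₁) (x₂ := x₂) (y := y) (Z := Z) (G := G)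
      (i := 1) (b := b) (c := c) (n := n) (N := 0 + b + c + S + 1) le_rfl hn (by omega)
    simp only [mul_assoc, pow_one, pow_zero, one_mul, pow_succ' x₂] at k0 k1 ⊢
    rw [e0]
    exact add_mem k0 (Submodule.smul_mem _ _ k1)
  · have k1 := mon_mem_pbwFilt (k := k) (x₁ := x₁) (x₂ := x₂) (y := y) (Z := Z) (G := G)
      (i := 0) (b := b + 1) (c := c) (n := n) (N := 1 + b + c + S + 1) (by omega) hn (by omega)
    have k2 := mon_mem_pbwFilt (k := k) (x₁ := x₁) (x₂ := x₂) (y := y) (Z := Z) (G := G)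
      (i := 1) (b := b) (c := c + 1) (n := n) (N := 1 + b + c + S + 1) le_rfl hn (by omega)
    simp only [mul_assoc, pow_one, pow_zero, one_mul, pow_succ' x₂, pow_succ' y] at k0 k1 k2 ⊢
    have e1 : ∀ u, x₂ * (x₁ * u) = y * u - x₁ * (x₂ * u) := by
      intro u
      rw [h.y_eq]; noncomm_ring
    have e2 : ∀ u, x₁ * (x₁ * u) = 0 := by
      intro u
      rw [← mul_assoc, h.sq, zero_mul]
    rw [e1, e0, mul_add, mul_smul_comm, e2, smul_zero, add_zero]
    exact sub_mem k1 k2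

theorem Z_mul_zMon_mem [CharZero k] (hq : q ≠ 0) (h : IsLstr q G x₁ x₂ y Z) (t : ℕ) {n : ℕ → ℕ}
    (hn : ∀ t, Even t → n t ≤ 1) :
    Z t * zMon Z (2 * G + 1) n ∈
      pbwFilt k G x₁ x₂ y Z (∑ t ∈ Finset.range (2 * G + 1), n t + 1) := by
  rcases lt_or_ge t (2 * G + 1) with ht | ht
  · obtain ⟨c, hc⟩ := exists_mul_zMon Z (h.qcomm hq) ht n
    rw [hc]
    refine Submodule.smul_mem _ _ ?_
    by_cases hev : Even t ∧ n t = 1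
    · obtain ⟨⟨j, rfl⟩, h1⟩ := hev
      rw [zMon_eq_zero Z ht (by rw [← two_mul]; exact h.even_mul_self j) (by simp [h1])]
      exact zero_mem _
    · have := mon_mem_pbwFilt (k := k) (x₁ := x₁) (x₂ := x₂) (y := y) (Z := Z) (G := G)
        (i := 0) (b := 0) (c := 0) (n := n + Pi.single t 1) (by omega) (fun s hs => ?_) le_rfl
      · simp only [pow_zero, one_mul, zero_add, Pi.add_apply, Finset.sum_add_distrib,
          Finset.sum_pi_single', Finset.mem_range, ht, if_true] at this
        exact this
      · by_cases hst : s = t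
        · subst hst
          have := hn s hs
          simp only [Pi.add_apply, Pi.single_eq_same]
          simp only [hs, true_and] at hev
          omega
        · simpa [hst] using hn s hs
  · rw [h.Z_eq_zero (by omega), zero_mul]
    exact zero_mem _

theorem Z_mul_pow_mul_zMon_mem [CharZero k] (hq : q ≠ 0) (h : IsLstr q G x₁ x₂ y Z) (c : ℕ)
    {n : ℕ → ℕ} (hn : ∀ t, Even t → n t ≤ 1) (t : ℕ) :
    Z t * (x₂ ^ c * zMon Z (2 * G + 1) n) ∈
      pbwFilt k G x₁ x₂ y Z (c + ∑ t ∈ Finset.range (2 * G + 1), n t + 1) := by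
  induction c generalizing t with
  | zero => simpa using h.Z_mul_zMon_mem hq t hn
  | succ c ih =>
    have hs : ((-1 : k) ^ t * q⁻¹) * ((-1) ^ t * q) = 1 := by
      rw [show (-1 : k) ^ t * q⁻¹ * ((-1) ^ t * q) = ((-1) ^ t * (-1) ^ t) * (q⁻¹ * q) by ring,
        ← mul_pow, inv_mul_cancel₀ hq]
      simp
    have e : ∀ u, Z t * (x₂ * u) = ((-1 : k) ^ t * q⁻¹) • (x₂ * (Z t * u) - Z (t + 1) * u) := by
      intro u
      rw [← mul_assoc x₂, h.x₂_Z, add_mul, add_sub_cancel_left, smul_mul_assoc, smul_smul, hs,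
        one_smul, mul_assoc]
    rw [pow_succ', mul_assoc, e]
    refine Submodule.smul_mem _ _ (sub_mem ?_ ?_)
    · exact pbwFilt_mono (by omega) (h.x₂_mul_mem (ih t))
    · exact pbwFilt_mono (by omega) (ih (t + 1))

theorem Z_mul_mem [CharZero k] (hq : q ≠ 0) (h : IsLstr q G x₁ x₂ y Z) (t : ℕ) {N : ℕ} {w : A}
    (hw : w ∈ pbwFilt k G x₁ x₂ y Z N) : Z t * w ∈ pbwFilt k G x₁ x₂ y Z (N + 1) := by
  refine mul_mem_of_mon _ (fun i b c n hi hn => ?_) hw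
  obtain ⟨h1, h2⟩ := h.x₁_Z_and_y_Z t
  have e1 : ∀ u, Z t * (x₁ * u) = (((-1 : k) ^ t * q)⁻¹) • (x₁ * (Z t * u)) := by
    intro u
    rw [← mul_assoc x₁, h1, smul_mul_assoc, smul_smul, inv_mul_cancel₀ (by simp [hq]), one_smul,
      mul_assoc]
  have e2 : ∀ u, Z t * (y * u) = ((q ^ 2)⁻¹) • (y * (Z t * u)) := by
    intro u
    rw [← mul_assoc y, h2, smul_mul_assoc, smul_smul, inv_mul_cancel₀ (by simp [hq]), one_smul,
      mul_assoc]
  have k1 : ∀ b, Z t * (y ^ b * (x₂ ^ c * zMon Z (2 * G + 1) n)) ∈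
      pbwFilt k G x₁ x₂ y Z (b + c + ∑ t ∈ Finset.range (2 * G + 1), n t + 1) := by
    intro b
    induction b with
    | zero => simpa using h.Z_mul_pow_mul_zMon_mem hq c hn t
    | succ b ih =>
      rw [pow_succ', mul_assoc, e2]
      exact Submodule.smul_mem _ _ (pbwFilt_mono (by omega) (h.y_mul_mem ih))
  simp only [mul_assoc]
  interval_cases i
  · simpa using k1 b
  · rw [pow_one, e1]
    exact Submodule.smul_mem _ _ (pbwFilt_mono (by omega) (h.x₁_mul_mem (k1 b)))

theorem pbwFilt_mul_mem [CharZero k] (hq : q ≠ 0) (h : IsLstr q G x₁ x₂ y Z) {M N : ℕ} {v w : A}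
    (hv : v ∈ pbwFilt k G x₁ x₂ y Z M) (hw : w ∈ pbwFilt k G x₁ x₂ y Z N) :
    v * w ∈ pbwFilt k G x₁ x₂ y Z (M + N) := by
  have hp : ∀ (a : A), (∀ {N : ℕ} {w : A}, w ∈ pbwFilt k G x₁ x₂ y Z N →
      a * w ∈ pbwFilt k G x₁ x₂ y Z (N + 1)) → ∀ (j : ℕ) {N : ℕ} {w : A},
      w ∈ pbwFilt k G x₁ x₂ y Z N → a ^ j * w ∈ pbwFilt k G x₁ x₂ y Z (j + N) := by
    intro a ha j
    induction j with
    | zero => intro N w hw; simpa using hw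
    | succ j ih =>
      intro N w hw
      rw [pow_succ', mul_assoc]
      exact pbwFilt_mono (by omega) (ha (ih hw))
  have hz : ∀ (m : ℕ) (n : ℕ → ℕ), zMon Z m n * w ∈
      pbwFilt k G x₁ x₂ y Z (∑ t ∈ Finset.range m, n t + N) := by
    intro m n
    induction m with
    | zero => simpa [zMon] using hw
    | succ m ih =>
      simp only [zMon, mul_assoc]
      exact pbwFilt_mono (by rw [Finset.sum_range_succ]; omega)
        (hp (Z m) (h.Z_mul_mem hq m) (n m) ih)
  have : pbwFilt k G x₁ x₂ y Z M ≤
      (pbwFilt k G x₁ x₂ y Z (M + N)).comap (LinearMap.mulRight k w) := by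
    refine Submodule.span_le.mpr ?_
    rintro _ ⟨i, b, c, n, hi, hn, hN, rfl⟩
    simp only [Submodule.comap_coe, Set.mem_preimage, LinearMap.mulRight_apply, SetLike.mem_coe,
      mul_assoc]
    exact pbwFilt_mono (by omega) (hp x₁ h.x₁_mul_mem i (hp y h.y_mul_mem b
      (hp x₂ h.x₂_mul_mem c (hz (2 * G + 1) n))))
  exact this hv

theorem pow_pbwFilt_le [CharZero k] (hq : q ≠ 0) (h : IsLstr q G x₁ x₂ y Z) (m j : ℕ) :
    pbwFilt k G x₁ x₂ y Z m ^ j ≤ pbwFilt k G x₁ x₂ y Z (m * j) := by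
  induction j with
  | zero =>
    rw [pow_zero, Submodule.one_le]
    exact one_mem_pbwFilt _
  | succ j ih =>
    rw [pow_succ, Submodule.mul_le]
    intro v hv w hw
    exact pbwFilt_mono (by rw [mul_add, mul_one]) (h.pbwFilt_mul_mem hq (ih hv) hw)

end IsLstr

theorem zMon_mem_pow {k A : Type*} [Field k] [Ring A] [Algebra k A] {Z : ℕ → A}
    {V : Submodule k A} {m : ℕ} (hZ : ∀ t < m, Z t ∈ V) (n : ℕ → ℕ) :
    zMon Z m n ∈ V ^ ∑ t ∈ Finset.range m, n t := by
  induction m with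
  | zero =>
    rw [Finset.range_zero, Finset.sum_empty, pow_zero]
    exact Submodule.one_le.mp le_rfl
  | succ m ih =>
    rw [Finset.sum_range_succ, add_comm, pow_add]
    exact Submodule.mul_mem_mul (Submodule.pow_mem_pow V (hZ m (by omega)) _)
      (ih fun t ht => hZ t (by omega))

namespace FockSpace

variable (k : Type*) [Field k]

/-- The Jordan–Wigner sign attached to the sites of even index below `t`. -/
def jwSign (t : ℕ) (n : ℕ → ℕ) : k :=
  (-1) ^ ∑ i ∈ Finset.range t, if Even i then n i else 0

/-- The sign `-1` if both sites are fermionic, `1` otherwise. -/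
def braid (s t : ℕ) : k := if Even s ∧ Even t then -1 else 1

/-- The coefficient of the creation operator at site `t`. -/
def upCoeff (t : ℕ) (n : ℕ → ℕ) : k :=
  if Even t then (if Even (n t) then jwSign k t n else 0) else 1

/-- The coefficient of the annihilation operator at site `t`. -/
def downCoeff (t : ℕ) (n : ℕ → ℕ) : k :=
  if Even t then (if Odd (n t) then jwSign k t n else 0) else (n t : k)

/-- The creation operator at site `t`: fermionic for even `t`, bosonic for odd `t`. -/
noncomputable def up (t : ℕ) : Module.End k ((ℕ → ℕ) →₀ k) :=
  Finsupp.linearCombination k fun n => upCoeff k t n • Finsupp.single (n + Pi.single t 1) 1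

/-- The annihilation operator at site `t`: fermionic for even `t`, bosonic for odd `t`. -/
noncomputable def down (t : ℕ) : Module.End k ((ℕ → ℕ) →₀ k) :=
  Finsupp.linearCombination k fun n => downCoeff k t n • Finsupp.single (n - Pi.single t 1) 1

/-- The diagonal operator multiplying `n` by `∏ c_i ^ n_i`. -/
noncomputable def diag (m : ℕ) (c : ℕ → k) : Module.End k ((ℕ → ℕ) →₀ k) :=
  Finsupp.linearCombination k fun n => (∏ i ∈ Finset.range m, c i ^ n i) • Finsupp.single n 1

variable {k}

theorem up_single (t : ℕ) (n : ℕ → ℕ) : up k t (Finsupp.single n 1) =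
    upCoeff k t n • Finsupp.single (n + Pi.single t 1) 1 := by simp [up]

theorem down_single (t : ℕ) (n : ℕ → ℕ) : down k t (Finsupp.single n 1) =
    downCoeff k t n • Finsupp.single (n - Pi.single t 1) 1 := by simp [down]

theorem diag_single (m : ℕ) (c : ℕ → k) (n : ℕ → ℕ) : diag k m c (Finsupp.single n 1) =
    (∏ i ∈ Finset.range m, c i ^ n i) • Finsupp.single n 1 := by simp [diag]

theorem end_ext {ι M : Type*} [AddCommGroup M] [Module k M] {f g : (ι →₀ k) →ₗ[k] M}
    (h : ∀ n, f (Finsupp.single n 1) = g (Finsupp.single n 1)) : f = g :=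
  Finsupp.lhom_ext' fun n => LinearMap.ext_ring (h n)

theorem jwSign_add_single (s t : ℕ) (n : ℕ → ℕ) :
    jwSign k t (n + Pi.single s 1) = (if s < t ∧ Even s then -1 else 1) * jwSign k t n := by
  unfold jwSign
  have h : ∀ i, (if Even i then (n + Pi.single s 1 : ℕ → ℕ) i else 0) =
      (Pi.single s (if Even s then 1 else 0) : ℕ → ℕ) i + if Even i then n i else 0 := by
    intro i
    by_cases hi : i = s
    · subst hi; by_cases h : Even i <;> simp [h, add_comm]
    · simp [hi]
  simp only [h, Finset.sum_add_distrib, Finset.sum_pi_single', Finset.mem_range, pow_add]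
  congr 1
  by_cases h1 : s < t <;> by_cases h2 : Even s <;> simp [h1, h2]

theorem jwSign_mul_self (t : ℕ) (n : ℕ → ℕ) : jwSign k t n * jwSign k t n = 1 := by
  unfold jwSign
  rw [← mul_pow]; simp

theorem jwSign_ne_zero (t : ℕ) (n : ℕ → ℕ) : jwSign k t n ≠ 0 := fun h => by
  simpa [h] using jwSign_mul_self (k := k) t n

theorem up_mul_up {s t : ℕ} (hst : s ≠ t) : up k s * up k t = braid k s t • (up k t * up k s) := by
  refine end_ext fun n => ?_
  simp only [Module.End.mul_apply, LinearMap.smul_apply, up_single, map_smul, smul_smul]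
  rw [add_right_comm n (Pi.single t 1)]
  congr 1
  simp only [upCoeff, braid, jwSign_add_single, Pi.add_apply, Pi.single_eq_of_ne hst,
    Pi.single_eq_of_ne hst.symm, add_zero]
  rcases lt_or_gt_of_ne hst with h | h <;> by_cases h1 : Even s <;> by_cases h2 : Even t <;>
    by_cases h3 : Even (n s) <;> by_cases h4 : Even (n t) <;> simp [h, h1, h2, h3, h4, h.not_gt] <;>
    ring

theorem up_mul_self {t : ℕ} (ht : Even t) : up k t * up k t = 0 := by
  refine end_ext fun n => ?_
  simp only [Module.End.mul_apply, up_single, map_smul, smul_smul]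
  by_cases h : Even (n t) <;> simp [upCoeff, ht, h, Nat.even_add_one]

theorem down_mul_up_self (t : ℕ) :
    down k t * up k t + (-1 : k) ^ t • (up k t * down k t) = 1 := by
  refine end_ext fun n => ?_
  simp only [Module.End.mul_apply, LinearMap.smul_apply, LinearMap.add_apply, up_single,
    down_single, map_smul, smul_smul, add_tsub_cancel_right, Module.End.one_apply]
  have hsub : 0 < n t → n - Pi.single t 1 + Pi.single t 1 = n := by
    intro h
    refine tsub_add_cancel_of_le ?_
    intro i
    by_cases hi : i = t
    · subst hi; simpa using Nat.succ_le_of_lt h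
    · simp [hi]
  by_cases ht : Even t
  · by_cases hn : Even (n t)
    · simp [upCoeff, downCoeff, ht, hn, jwSign_add_single, jwSign_mul_self]
    · have h0 : 0 < n t := (Nat.not_even_iff_odd.mp hn).pos
      have h1 : Even (n t - 1) := by
        obtain ⟨j, hj⟩ := Nat.not_even_iff_odd.mp hn
        exact ⟨j, by omega⟩
      have h2 := jwSign_add_single (k := k) t t (n - Pi.single t 1)
      rw [hsub h0] at h2
      simp only [lt_irrefl, false_and, if_false, one_mul] at h2
      simp [upCoeff, downCoeff, ht, hn, h1, hsub h0, ← h2, jwSign_mul_self,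
        Nat.not_even_iff_odd.mp hn]
  · rw [Nat.not_even_iff_odd] at ht
    rcases Nat.eq_zero_or_pos (n t) with h0 | h0
    · simp [upCoeff, downCoeff, Nat.not_even_iff_odd.mpr ht, h0]
    · simp only [upCoeff, downCoeff, Nat.not_even_iff_odd.mpr ht, if_false, hsub h0,
        ht.neg_one_pow, ← add_smul]
      convert one_smul k _ using 2
      simp

theorem down_mul_up {s t : ℕ} (hst : s ≠ t) :
    down k s * up k t = braid k s t • (up k t * down k s) := by
  refine end_ext fun n => ?_
  simp only [Module.End.mul_apply, LinearMap.smul_apply, up_single, down_single, map_smul,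
    smul_smul]
  have hv : n + Pi.single t 1 - Pi.single s 1 = n - Pi.single s 1 + Pi.single t 1 := by
    funext i
    by_cases h1 : i = s
    · subst h1; simp [hst]
    · simp [h1]
  rw [hv]
  congr 1
  rcases Nat.eq_zero_or_pos (n s) with h0 | h0
  · simp [downCoeff, h0, hst]
  · have hsub : n - Pi.single s 1 + Pi.single s 1 = n := by
      refine tsub_add_cancel_of_le ?_
      intro i
      by_cases hi : i = s
      · subst hi; simpa using Nat.succ_le_of_lt h0
      · simp [hi]
    have h2 := jwSign_add_single (k := k) s t (n - Pi.single s 1)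
    rw [hsub] at h2
    simp only [upCoeff, downCoeff, braid, jwSign_add_single, h2, Pi.add_apply, Pi.sub_apply,
      Pi.single_eq_of_ne hst, Pi.single_eq_of_ne hst.symm, add_zero, tsub_zero]
    rcases lt_or_gt_of_ne hst with h | h <;> by_cases h1 : Even s <;> by_cases h2 : Even t <;>
      by_cases h3 : Even (n s) <;> by_cases h4 : Even (n t) <;>
      simp [h, h1, h2, h3, h4, h.not_gt, ← Nat.not_even_iff_odd] <;> ring

theorem diag_mul_up {m t : ℕ} (ht : t < m) (c : ℕ → k) :
    diag k m c * up k t = c t • (up k t * diag k m c) := by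
  refine end_ext fun n => ?_
  simp only [Module.End.mul_apply, LinearMap.smul_apply, up_single, diag_single, map_smul,
    smul_smul, Pi.add_apply, pow_add, Finset.prod_mul_distrib]
  have : ∏ x ∈ Finset.range m, c x ^ (Pi.single t 1 : ℕ → ℕ) x = c t := by
    rw [Finset.prod_eq_single t]
    · simp
    · intro b _ hb; simp [hb]
    · simp [ht]
  rw [this]
  congr 1; ring

theorem down_mul_diag {m t : ℕ} (ht : t < m) (c : ℕ → k) :
    down k t * diag k m c = c t • (diag k m c * down k t) := by
  refine end_ext fun n => ?_
  simp only [Module.End.mul_apply, LinearMap.smul_apply, down_single, diag_single, map_smul,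
    smul_smul]
  rcases Nat.eq_zero_or_pos (n t) with h0 | h0
  · simp [downCoeff, h0]
  · have h1 : (n - Pi.single t 1 : ℕ → ℕ) t + 1 = n t := by simp; omega
    have h2 : ∀ i, i ≠ t → (n - Pi.single t 1 : ℕ → ℕ) i = n i := fun i hi => by simp [hi]
    generalize n - Pi.single t 1 = n' at h1 h2 ⊢
    congr 1
    have : ∏ x ∈ Finset.range m, c x ^ n x = c t * ∏ x ∈ Finset.range m, c x ^ n' x := by
      rw [← Finset.mul_prod_erase _ _ (Finset.mem_range.mpr ht),
        ← Finset.mul_prod_erase _ (fun x => c x ^ n' x) (Finset.mem_range.mpr ht), ← mul_assoc,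
        ← pow_succ', h1]
      congr 1
      exact Finset.prod_congr rfl fun i hi => by rw [h2 i (Finset.ne_of_mem_erase hi)]
    rw [this]; ring

variable (k) in
/-- The differential `∑ a_{s+1} ∂_s`, taking the creation operator `a_t` to `a_{t+1}`. -/
noncomputable def diffl (G : ℕ) : Module.End k ((ℕ → ℕ) →₀ k) :=
  ∑ s ∈ Finset.range (2 * G), up k (s + 1) * down k s

theorem up_mul_down_mul_up (s t : ℕ) :
    up k (s + 1) * down k s * up k t + (-1 : k) ^ t • (up k t * (up k (s + 1) * down k s)) =
      if s = t then up k (t + 1) else 0 := by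
  by_cases hst : s = t
  · subst hst
    rw [if_pos rfl]
    have hself := congrArg (up k (s + 1) * ·) (down_mul_up_self (k := k) s)
    have hb : braid k s (s + 1) = 1 := by simp [braid, Nat.even_add_one]
    simp only [mul_add, mul_one, mul_smul_comm] at hself
    refine Eq.trans ?_ hself
    rw [mul_assoc, ← mul_assoc (up k s), up_mul_up (k := k) (s := s) (t := s + 1) (by omega), hb,
      one_smul, mul_assoc (up k (s + 1))]
  · rw [if_neg hst, mul_assoc, down_mul_up hst, mul_smul_comm, ← mul_assoc, ← mul_assoc]
    by_cases h1 : s + 1 = t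
    · subst h1
      by_cases hs : Even s
      · have h2 : ¬ Even (s + 1) := by simpa [Nat.even_add_one] using hs
        simp only [braid, h2, and_false, if_false, one_smul,
          (Nat.not_even_iff_odd.mp h2).neg_one_pow]
        module
      · rw [up_mul_self (by simpa [Nat.even_add_one] using hs)]
        simp
    · rw [up_mul_up (k := k) (s := s + 1) (t := t) h1, smul_mul_assoc, smul_smul, ← add_smul]
      convert zero_smul k _
      by_cases hs : Even s <;> by_cases ht : Even t <;>
        simp [braid, hs, ht, Nat.even_add_one, Odd.neg_one_pow, Nat.not_even_iff_odd.mp] 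

theorem diffl_mul_up (G t : ℕ) :
    diffl k G * up k t + (-1 : k) ^ t • (up k t * diffl k G) =
      if t < 2 * G then up k (t + 1) else 0 := by
  rw [diffl, Finset.sum_mul, Finset.mul_sum, Finset.smul_sum, ← Finset.sum_add_distrib]
  simp only [up_mul_down_mul_up, Finset.sum_ite_eq', Finset.mem_range]

theorem diag_mul_diffl (G : ℕ) {c : ℕ → k} (r : k) (hc : ∀ t, c (t + 1) = r * c t) :
    diag k (2 * G + 1) c * diffl k G = r • (diffl k G * diag k (2 * G + 1) c) := by
  rw [diffl, Finset.sum_mul, Finset.mul_sum, Finset.smul_sum]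
  refine Finset.sum_congr rfl fun s hs => ?_
  rw [Finset.mem_range] at hs
  rw [← mul_assoc, diag_mul_up (by omega), mul_assoc (up k (s + 1)) (down k s),
    down_mul_diag (by omega), smul_mul_assoc, mul_smul_comm, smul_smul, hc, mul_assoc]

theorem diag_mul_diag (m : ℕ) (c c' : ℕ → k) :
    diag k m c * diag k m c' = diag k m c' * diag k m c := by
  refine end_ext fun n => ?_
  simp only [Module.End.mul_apply, diag_single, map_smul, smul_smul, mul_comm]

/-- The braiding automorphism of `x₂` on the Fock space. -/
noncomputable def sigma (G : ℕ) (q : k) : Module.End k ((ℕ → ℕ) →₀ k) :=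
  diag k (2 * G + 1) fun t => (-1) ^ t * q

/-- The cocycle twist turning super-commutation into `q`-commutation. -/
noncomputable def twist (G : ℕ) (q : k) : Module.End k ((ℕ → ℕ) →₀ k) :=
  diag k (2 * G + 1) fun t => (-q)⁻¹ ^ t

/-- The operator by which `z_t` acts on the Fock space. -/
noncomputable def zeta (G : ℕ) (q : k) (t : ℕ) : Module.End k ((ℕ → ℕ) →₀ k) :=
  if t ≤ 2 * G then up k t * twist G q else 0

variable {G : ℕ} {q : k}

theorem twist_mul_up {t : ℕ} (ht : t ≤ 2 * G) :
    twist G q * up k t = (-q)⁻¹ ^ t • (up k t * twist G q) := diag_mul_up (by omega) _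

theorem zeta_eq_zero {t : ℕ} (ht : 2 * G < t) : zeta G q t = 0 := if_neg (by omega)

theorem sigma_mul_zeta (t : ℕ) :
    sigma G q * zeta G q t = ((-1) ^ t * q) • (zeta G q t * sigma G q) := by
  rcases le_or_gt t (2 * G) with ht | ht
  · rw [zeta, if_pos ht, ← mul_assoc, sigma, diag_mul_up (by omega), smul_mul_assoc, mul_assoc,
      twist, diag_mul_diag, mul_assoc]
  · simp [zeta_eq_zero ht]

theorem sigma_mul_diffl : sigma G q * diffl k G = (-1 : k) • (diffl k G * sigma G q) :=
  diag_mul_diffl G _ fun t => by ring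

theorem diffl_mul_zeta (hq : q ≠ 0) (t : ℕ) :
    diffl k G * zeta G q t = zeta G q (t + 1) + ((-1) ^ t * q) • (zeta G q t * diffl k G) := by
  rcases le_or_gt t (2 * G) with ht | ht
  · have h1 := congrArg (· * twist G q) (diffl_mul_up (k := k) G t)
    have h2 : twist G q * diffl k G = (-q)⁻¹ • (diffl k G * twist G q) :=
      diag_mul_diffl G _ fun t => by ring
    have h3 : zeta G q (t + 1) =
        (if t < 2 * G then up k (t + 1) else 0) * twist G q := by
      by_cases h : t < 2 * G
      · rw [zeta, if_pos h, if_pos (by omega)]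
      · rw [zeta, if_neg h, if_neg (by omega), zero_mul]
    rw [h3, ← h1, zeta, if_pos ht, mul_assoc (up k t), h2, add_mul, smul_mul_assoc, mul_smul_comm,
      smul_smul]
    have h4 : (-1 : k) ^ t * q * (-q)⁻¹ = -(-1) ^ t := by
      field_simp
    rw [h4]
    simp only [mul_assoc]
    module
  · simp [zeta_eq_zero ht, zeta_eq_zero (show 2 * G < t + 1 by omega)]

theorem zeta_even_mul_self (j : ℕ) : zeta G q (2 * j) * zeta G q (2 * j) = 0 := by
  rcases le_or_gt (2 * j) (2 * G) with ht | ht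
  · rw [zeta, if_pos ht, mul_assoc, ← mul_assoc (twist G q), twist_mul_up ht, smul_mul_assoc,
      mul_smul_comm, mul_assoc (up k (2 * j)), ← mul_assoc, up_mul_self (by simp), zero_mul,
      smul_zero]
  · simp [zeta_eq_zero ht]

theorem zeta_adj {t : ℕ} (ht : t + 1 ≤ 2 * G) :
    zeta G q t * zeta G q (t + 1) + q⁻¹ • (zeta G q (t + 1) * zeta G q t) = 0 := by
  have e : ∀ s t, s ≤ 2 * G → t ≤ 2 * G → zeta G q s * zeta G q t =
      (-q)⁻¹ ^ t • (up k s * up k t * (twist G q * twist G q)) := by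
    intro s t hs ht
    rw [zeta, zeta, if_pos ht, if_pos hs, mul_assoc, ← mul_assoc (twist G q), twist_mul_up ht,
      smul_mul_assoc, mul_smul_comm, mul_assoc, mul_assoc]
  have hb : braid k t (t + 1) = 1 := by simp [braid, Nat.even_add_one]
  rw [e _ _ (by omega) ht, e _ _ ht (by omega), up_mul_up (k := k) (s := t) (t := t + 1) (by omega),
    hb, one_smul, smul_smul, ← add_smul]
  convert zero_smul k _
  rw [pow_succ, inv_neg]
  ring

theorem zeta_single {t : ℕ} (hq : q ≠ 0) (ht : t ≤ 2 * G) {n : ℕ → ℕ} (hn : Even t → n t = 0) :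
    ∃ c : k, c ≠ 0 ∧ zeta G q t (Finsupp.single n 1) = c • Finsupp.single (n + Pi.single t 1) 1 := by
  refine ⟨(∏ i ∈ Finset.range (2 * G + 1), ((-q)⁻¹ ^ i) ^ n i) * upCoeff k t n,
    mul_ne_zero (Finset.prod_ne_zero_iff.mpr fun i _ => by simp [hq]) ?_, ?_⟩
  · by_cases h : Even t
    · simpa [upCoeff, h, hn h] using jwSign_ne_zero t n
    · simp [upCoeff, h]
  · rw [zeta, if_pos ht, Module.End.mul_apply, twist, diag_single, map_smul, up_single, smul_smul]

theorem zeta_pow_single {t : ℕ} (hq : q ≠ 0) (ht : t ≤ 2 * G) {n : ℕ → ℕ} (hn : n t = 0) (j : ℕ)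
    (hj : Even t → j ≤ 1) :
    ∃ c : k, c ≠ 0 ∧
      (zeta G q t ^ j) (Finsupp.single n 1) = c • Finsupp.single (n + Pi.single t j) 1 := by
  induction j with
  | zero => exact ⟨1, one_ne_zero, by simp⟩
  | succ j ih =>
    obtain ⟨c, hc, h⟩ := ih fun h => by have := hj h; omega
    obtain ⟨d, hd, h'⟩ := zeta_single (G := G) hq ht (n := n + Pi.single t j) fun h => by
      have := hj h
      simp [hn]; omega
    refine ⟨c * d, mul_ne_zero hc hd, ?_⟩
    rw [pow_succ', Module.End.mul_apply, h, map_smul, h', smul_smul, add_assoc, ← Pi.single_add]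

theorem zMon_zeta_single (hq : q ≠ 0) (n : ℕ → ℕ) (hn : ∀ t, Even t → n t ≤ 1) {m : ℕ}
    (hm : m ≤ 2 * G + 1) : ∃ c : k, c ≠ 0 ∧ zMon (zeta G q) m n (Finsupp.single 0 1) =
      c • Finsupp.single (fun t => if t < m then n t else 0) 1 := by
  induction m with
  | zero => exact ⟨1, one_ne_zero, by simp [zMon]; rfl⟩
  | succ m ih =>
    obtain ⟨c, hc, h⟩ := ih (by omega)
    obtain ⟨d, hd, h'⟩ := zeta_pow_single (G := G) hq (t := m) (by omega)
      (n := fun t => if t < m then n t else 0) (by simp) (n m) (hn m)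
    refine ⟨c * d, mul_ne_zero hc hd, ?_⟩
    rw [zMon, Module.End.mul_apply, h, map_smul, h', smul_smul]
    congr 2
    funext t
    rcases lt_trichotomy t m with h | rfl | h
    · simp [h, h.ne, h.trans (Nat.lt_succ_self m)]
    · simp
    · simp [h.ne', h.not_gt, show ¬ t < m + 1 by omega]

theorem sigma_pow_single (hq : q ≠ 0) (j : ℕ) (n : ℕ → ℕ) :
    ∃ c : k, c ≠ 0 ∧ (sigma G q ^ j) (Finsupp.single n 1) = c • Finsupp.single n 1 := by
  induction j with
  | zero => exact ⟨1, one_ne_zero, by simp⟩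
  | succ j ih =>
    obtain ⟨c, hc, h⟩ := ih
    refine ⟨c * ∏ i ∈ Finset.range (2 * G + 1), ((-1) ^ i * q) ^ n i,
      mul_ne_zero hc (Finset.prod_ne_zero_iff.mpr fun i _ => by simp [hq]), ?_⟩
    rw [pow_succ', Module.End.mul_apply, h, map_smul, sigma, diag_single, smul_smul]

variable (k)

/-- Left multiplication by `x₁` on the basis `x₁^i x₂₁^b x₂^c` of the super Jordan plane. -/
noncomputable def mulX₁ : Module.End k ((Fin 2 × ℕ × ℕ) →₀ k) :=
  Finsupp.linearCombination k fun p => if p.1 = 0 then Finsupp.single (1, p.2) 1 else 0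

/-- Left multiplication by `x₂` on the basis `x₁^i x₂₁^b x₂^c` of the super Jordan plane. -/
noncomputable def mulX₂ : Module.End k ((Fin 2 × ℕ × ℕ) →₀ k) :=
  Finsupp.linearCombination k fun p =>
    if p.1 = 0 then Finsupp.single (0, p.2.1, p.2.2 + 1) 1 + (p.2.1 : k) • Finsupp.single (1, p.2) 1
    else Finsupp.single (0, p.2.1 + 1, p.2.2) 1 - Finsupp.single (1, p.2.1, p.2.2 + 1) 1

/-- Left multiplication by `x₂₁` on the basis `x₁^i x₂₁^b x₂^c` of the super Jordan plane. -/
noncomputable def mulX₂₁ : Module.End k ((Fin 2 × ℕ × ℕ) →₀ k) :=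
  Finsupp.linearCombination k fun p => Finsupp.single (p.1, p.2.1 + 1, p.2.2) 1

variable {k}

theorem mulX₁_zero (b c : ℕ) : mulX₁ k (Finsupp.single (0, b, c) 1) = Finsupp.single (1, b, c) 1 := by
  simp [mulX₁]

theorem mulX₁_one (b c : ℕ) : mulX₁ k (Finsupp.single (1, b, c) 1) = 0 := by
  simp [mulX₁]

theorem mulX₂_zero (b c : ℕ) : mulX₂ k (Finsupp.single (0, b, c) 1) =
    Finsupp.single (0, b, c + 1) 1 + (b : k) • Finsupp.single (1, b, c) 1 := by
  simp [mulX₂]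

theorem mulX₂_one (b c : ℕ) : mulX₂ k (Finsupp.single (1, b, c) 1) =
    Finsupp.single (0, b + 1, c) 1 - Finsupp.single (1, b, c + 1) 1 := by
  simp [mulX₂]

theorem mulX₂₁_single (i : Fin 2) (b c : ℕ) : mulX₂₁ k (Finsupp.single (i, b, c) 1) =
    Finsupp.single (i, b + 1, c) 1 := by
  simp [mulX₂₁]

theorem mulX₁_mul_self : mulX₁ k * mulX₁ k = 0 := by
  refine end_ext fun ⟨i, b, c⟩ => ?_
  fin_cases i <;> simp [mulX₁_zero, mulX₁_one]

theorem mulX₂₁_eq : mulX₂₁ k = mulX₂ k * mulX₁ k + mulX₁ k * mulX₂ k := by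
  refine end_ext fun ⟨i, b, c⟩ => ?_
  fin_cases i <;> simp [mulX₁_zero, mulX₁_one, mulX₂_zero, mulX₂_one, mulX₂₁_single, -Finsupp.smul_single]

theorem mulX₂_mul_mulX₂₁ :
    mulX₂ k * mulX₂₁ k = mulX₂₁ k * mulX₂ k + mulX₁ k * mulX₂₁ k := by
  refine end_ext fun ⟨i, b, c⟩ => ?_
  fin_cases i
  · simp only [Fin.zero_eta, Module.End.mul_apply, LinearMap.add_apply, mulX₁_zero, mulX₂_zero,
      mulX₂₁_single, map_add, map_smul]
    push_cast
    module
  · simp [mulX₁_one, mulX₂_one, mulX₂₁_single]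

theorem mulX₁_pow (i : Fin 2) (b c : ℕ) :
    (mulX₁ k ^ (i : ℕ)) (Finsupp.single (0, b, c) 1) = Finsupp.single (i, b, c) 1 := by
  fin_cases i <;> simp [mulX₁_zero]

theorem mulX₂₁_pow (i : Fin 2) (b c j : ℕ) :
    (mulX₂₁ k ^ j) (Finsupp.single (i, b, c) 1) = Finsupp.single (i, b + j, c) 1 := by
  induction j with
  | zero => simp
  | succ j ih => rw [pow_succ', Module.End.mul_apply, ih, mulX₂₁_single, add_assoc]

variable (k) in
/-- The tensor product `V ⊗ W` over `k`. -/
def Tens (V W : Type*) [AddCommGroup V] [Module k V] [AddCommGroup W] [Module k W] : Type _ :=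
  TensorProduct k V W

section tens

variable {V W : Type*} [AddCommGroup V] [Module k V] [AddCommGroup W] [Module k W]

noncomputable instance : AddCommGroup (Tens k V W) :=
  inferInstanceAs (AddCommGroup (TensorProduct k V W))

noncomputable instance : Module k (Tens k V W) :=
  inferInstanceAs (Module k (TensorProduct k V W))

variable (k) in
/-- The pure tensor `v ⊗ w`. -/
noncomputable def tmul (v : V) (w : W) : Tens k V W := TensorProduct.tmul k v w

/-- The tensor product of two endomorphisms. -/
noncomputable def tens (f : Module.End k V) (g : Module.End k W) : Module.End k (Tens k V W) :=
  TensorProduct.map f g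

theorem tens_tmul (f : Module.End k V) (g : Module.End k W) (v : V) (w : W) :
    tens f g (tmul k v w) = tmul k (f v) (g w) := rfl

theorem smul_tmul (r : k) (v : V) (w : W) : tmul k (r • v) w = r • tmul k v w :=
  (TensorProduct.smul_tmul' r v w).symm

theorem tens_mul (f f' : Module.End k V) (g g' : Module.End k W) :
    tens (f * f') (g * g') = tens f g * tens f' g' := TensorProduct.map_mul f f' g g'

theorem tens_one : tens (1 : Module.End k V) (1 : Module.End k W) = 1 := TensorProduct.map_one

theorem tens_pow (f : Module.End k V) (g : Module.End k W) (n : ℕ) :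
    tens f g ^ n = tens (f ^ n) (g ^ n) := by
  induction n with
  | zero => simp [tens_one]
  | succ n ih => rw [pow_succ, ih, ← tens_mul, ← pow_succ, ← pow_succ]

theorem tens_add_left (f f' : Module.End k V) (g : Module.End k W) :
    tens (f + f') g = tens f g + tens f' g := TensorProduct.map_add_left f f' g

theorem tens_add_right (f : Module.End k V) (g g' : Module.End k W) :
    tens f (g + g') = tens f g + tens f g' := TensorProduct.map_add_right f g g'

theorem tens_smul_left (r : k) (f : Module.End k V) (g : Module.End k W) :
    tens (r • f) g = r • tens f g := TensorProduct.map_smul_left r f g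

theorem tens_zero_left (g : Module.End k W) : tens (0 : Module.End k V) g = 0 :=
  TensorProduct.map_zero_left g

theorem tens_zero_right (f : Module.End k V) : tens f (0 : Module.End k W) = 0 :=
  TensorProduct.map_zero_right f

end tens

variable (k) in
/-- The space carrying the representation: the Fock space tensored with the super Jordan plane. -/
abbrev FockRep : Type _ := Tens k ((ℕ → ℕ) →₀ k) ((Fin 2 × ℕ × ℕ) →₀ k)

/-- The action of `x₁`. -/
noncomputable def opX₁ (G : ℕ) (q : k) : Module.End k (FockRep k) := tens (sigma G q) (mulX₁ k)

/-- The action of `x₂`. -/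
noncomputable def opX₂ (G : ℕ) (q : k) : Module.End k (FockRep k) :=
  tens (diffl k G) 1 + tens (sigma G q) (mulX₂ k)

/-- The action of `x₂₁`. -/
noncomputable def opX₂₁ (G : ℕ) (q : k) : Module.End k (FockRep k) :=
  tens (sigma G q * sigma G q) (mulX₂₁ k)

/-- The action of `z_t`. -/
noncomputable def opZ (G : ℕ) (q : k) (t : ℕ) : Module.End k (FockRep k) := tens (zeta G q t) 1

theorem isLstr (hq : q ≠ 0) :
    IsLstr q G (opX₁ G q) (opX₂ G q) (opX₂₁ G q) (opZ G q) where
  sq := by rw [opX₁, ← tens_mul, mulX₁_mul_self, tens_zero_right]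
  y_eq := by
    simp only [opX₁, opX₂, opX₂₁, add_mul, mul_add, ← tens_mul, mul_one, one_mul, mulX₂₁_eq,
      tens_add_right, sigma_mul_diffl, tens_smul_left]
    module
  x₂_y := by
    simp only [opX₁, opX₂, opX₂₁, add_mul, mul_add, ← tens_mul, mul_one, one_mul, mulX₂_mul_mulX₂₁,
      tens_add_right]
    have : sigma G q * sigma G q * diffl k G = diffl k G * (sigma G q * sigma G q) := by
      rw [mul_assoc, sigma_mul_diffl, mul_smul_comm, ← mul_assoc, sigma_mul_diffl, smul_mul_assoc,
        smul_smul, mul_assoc]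
      simp
    rw [this, mul_assoc (sigma G q)]
    abel
  succ t := by
    simp only [opX₂, opZ, add_mul, mul_add, ← tens_mul, mul_one, one_mul, diffl_mul_zeta hq,
      sigma_mul_zeta, tens_add_left, tens_smul_left]
    module
  x₁_zero := by
    simp only [opX₁, opZ, ← tens_mul, mul_one, one_mul, sigma_mul_zeta,
      tens_smul_left]
    simp
  y_zero := by
    simp only [opX₂₁, opZ, ← tens_mul, mul_one, one_mul, mul_assoc, sigma_mul_zeta, mul_smul_comm,
      tens_smul_left]
    rw [← mul_assoc (sigma G q) (zeta G q 0), sigma_mul_zeta, smul_mul_assoc,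
      tens_smul_left, smul_smul, mul_assoc (zeta G q 0)]
    simp [pow_two]
  top := by rw [opZ, zeta_eq_zero (by omega), tens_zero_left]
  even_sq j _ := by rw [opZ, ← tens_mul, zeta_even_mul_self, tens_zero_left]
  adj j h1 hj := by
    obtain ⟨j, rfl⟩ := Nat.exists_eq_add_of_le' h1
    have e : 2 * (j + 1) - 1 = 2 * j + 1 := by omega
    have e' : 2 * (j + 1) = 2 * j + 1 + 1 := by omega
    rw [e, e', opZ, opZ, ← tens_mul, ← tens_mul, ← tens_smul_left,
      mul_one, ← tens_add_left, zeta_adj (by omega), tens_zero_left]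

variable (k) in
/-- The span of the tensors `w ⊗ x₁^i x₂₁^b x₂^j` with `j < c`. -/
noncomputable def lowerTerms (i : Fin 2) (b c : ℕ) :
    Submodule k (FockRep k) :=
  Submodule.span k {v | ∃ w, ∃ j < c, v = tmul k w (Finsupp.single (i, b, j) 1)}

theorem mulX₂_pow_tmul (c : ℕ) (w : (ℕ → ℕ) →₀ k) :
    (opX₂ G q ^ c) (tmul k w (Finsupp.single (0, 0, 0) 1)) -
      tmul k ((sigma G q ^ c) w) (Finsupp.single (0, 0, c) 1) ∈ lowerTerms k 0 0 c := by
  induction c with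
  | zero => simp
  | succ c ih =>
    set T := opX₂ G q with hT
    have hTs : ∀ (u : (ℕ → ℕ) →₀ k) (j : ℕ), T (tmul k u (Finsupp.single (0, 0, j) 1)) =
        tmul k (diffl k G u) (Finsupp.single (0, 0, j) 1) +
          tmul k (sigma G q u) (Finsupp.single (0, 0, j + 1) 1) := by
      intro u j
      rw [hT, opX₂, LinearMap.add_apply, tens_tmul, tens_tmul, mulX₂_zero]
      simp
    have hlow : ∀ v ∈ lowerTerms k 0 0 c, T v ∈ lowerTerms k 0 0 (c + 1) := by
      have : lowerTerms k 0 0 c ≤ (lowerTerms k 0 0 (c + 1)).comap T := by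
        refine Submodule.span_le.mpr ?_
        rintro _ ⟨u, j, hj, rfl⟩
        rw [SetLike.mem_coe, Submodule.mem_comap, hTs]
        exact add_mem (Submodule.subset_span ⟨_, j, by omega, rfl⟩)
          (Submodule.subset_span ⟨_, j + 1, by omega, rfl⟩)
      exact this
    have h1 := hlow _ ih
    rw [map_sub, hTs, ← Module.End.mul_apply, ← pow_succ', ← Module.End.mul_apply (sigma G q),
      ← pow_succ'] at h1
    have h2 : tmul k (diffl k G ((sigma G q ^ c) w)) (Finsupp.single (0, 0, c) 1) ∈
        lowerTerms k 0 0 (c + 1) := Submodule.subset_span ⟨_, c, by omega, rfl⟩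
    convert add_mem h1 h2 using 1
    abel

theorem tens_pow_mul_tens_pow_tmul (w : (ℕ → ℕ) →₀ k) (i : Fin 2) (b j : ℕ) :
    (opX₁ G q ^ (i : ℕ) *
      opX₂₁ G q ^ b)
        (tmul k w (Finsupp.single (0, 0, j) 1)) =
      tmul k ((sigma G q ^ ((i : ℕ) + 2 * b)) w) (Finsupp.single (i, b, j) 1) := by
  rw [opX₁, opX₂₁, tens_pow, tens_pow, Module.End.mul_apply, tens_tmul,
    mulX₂₁_pow, tens_tmul, zero_add, mulX₁_pow, ← pow_two, ← pow_mul,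
    ← Module.End.mul_apply, ← pow_add]

theorem zMon_tens_tmul (w : (ℕ → ℕ) →₀ k) (g : (Fin 2 × ℕ × ℕ) →₀ k) (m : ℕ) (n : ℕ → ℕ) :
    zMon (opZ G q) m n (tmul k w g) = tmul k (zMon (zeta G q) m n w) g := by
  induction m with
  | zero => rfl
  | succ m ih =>
    rw [zMon, zMon, Module.End.mul_apply, ih, opZ, tens_pow, tens_tmul, one_pow]
    rfl

/-- Triangularity of the PBW monomials acting on the vacuum. -/
theorem monomial_vacuum (hq : q ≠ 0) (i : Fin 2) (b c : ℕ) (n : ℕ → ℕ)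
    (hn : ∀ t, Even t → n t ≤ 1) (hn' : ∀ t, 2 * G + 1 ≤ t → n t = 0) :
    ∃ a : k, a ≠ 0 ∧
      (opX₁ G q ^ (i : ℕ) *
        opX₂₁ G q ^ b *
        opX₂ G q ^ c *
        zMon (opZ G q) (2 * G + 1) n)
        (tmul k (Finsupp.single 0 1) (Finsupp.single (0, 0, 0) 1)) -
        a • (tmul k (Finsupp.single n 1) (Finsupp.single (i, b, c) 1)) ∈ lowerTerms k i b c := by
  obtain ⟨a, ha, h⟩ := zMon_zeta_single (G := G) hq n hn le_rfl
  obtain ⟨d, hd, h'⟩ := sigma_pow_single (G := G) hq ((i : ℕ) + 2 * b + c) n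
  have hnn : (fun t => if t < 2 * G + 1 then n t else 0) = n := by
    funext t
    by_cases ht : t < 2 * G + 1
    · simp [ht]
    · simp [ht, hn' t (by omega)]
  rw [hnn] at h
  refine ⟨a * d, mul_ne_zero ha hd, ?_⟩
  rw [Module.End.mul_apply, zMon_tens_tmul, h, smul_tmul, map_smul, mul_smul,
    ← smul_sub, Module.End.mul_apply]
  refine Submodule.smul_mem _ _ ?_
  have h1 := mulX₂_pow_tmul (G := G) (q := q) c (Finsupp.single n (1 : k))
  set P := opX₁ G q ^ (i : ℕ) *
    opX₂₁ G q ^ b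
  have hlow : lowerTerms k 0 0 c ≤ (lowerTerms k i b c).comap P := by
    refine Submodule.span_le.mpr ?_
    rintro _ ⟨u, j, hj, rfl⟩
    rw [SetLike.mem_coe, Submodule.mem_comap, tens_pow_mul_tens_pow_tmul]
    exact Submodule.subset_span ⟨_, j, hj, rfl⟩
  have h2 := hlow h1
  rw [Submodule.mem_comap, map_sub, tens_pow_mul_tens_pow_tmul, ← Module.End.mul_apply (sigma G q ^ _),
    ← pow_add, h', smul_tmul] at h2
  exact h2

variable (k) in
/-- The coordinate functional of `W ⊗ H` at a pair of basis vectors. -/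
noncomputable def coord (n : ℕ → ℕ) (p : Fin 2 × ℕ × ℕ) :
    (FockRep k) →ₗ[k] k :=
  (TensorProduct.lid k k).toLinearMap ∘ₗ
    TensorProduct.map (Finsupp.lapply n) (Finsupp.lapply p)

theorem coord_tmul (n : ℕ → ℕ) (p : Fin 2 × ℕ × ℕ) (w : (ℕ → ℕ) →₀ k)
    (g : (Fin 2 × ℕ × ℕ) →₀ k) : coord k n p (tmul k w g) = w n * g p := by
  change TensorProduct.lid k k (TensorProduct.map (Finsupp.lapply n) (Finsupp.lapply p)
    (TensorProduct.tmul k w g)) = _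
  simp

theorem coord_lowerTerms (n : ℕ → ℕ) (p : Fin 2 × ℕ × ℕ) {i : Fin 2} {b c : ℕ} (hc : c ≤ p.2.2)
    {v} (hv : v ∈ lowerTerms k i b c) : coord k n p v = 0 := by
  have : lowerTerms k i b c ≤ LinearMap.ker (coord k n p) := by
    refine Submodule.span_le.mpr ?_
    rintro _ ⟨u, j, hj, rfl⟩
    rw [SetLike.mem_coe, LinearMap.mem_ker, coord_tmul, Finsupp.single_eq_of_ne, mul_zero]
    rintro rfl
    exact absurd hc (by simpa using hj)
  exact this hv

end FockSpace

section Presentation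

variable {k : Type*} [Field k] {q : k} {G : ℕ}

theorem mkAlgHom_eq_zero {a : FreeAlgebra k (Fin 3)} (h : lstrRel k q G a 0) :
    RingQuot.mkAlgHom k (lstrRel k q G) a = 0 := by
  rw [RingQuot.mkAlgHom_rel k h, map_zero]

/-- The generators of the presented algebra satisfy its defining relations. -/
theorem isLstr_mkAlgHom : IsLstr q G (RingQuot.mkAlgHom k (lstrRel k q G) (X k 0))
    (RingQuot.mkAlgHom k (lstrRel k q G) (X k 1)) (RingQuot.mkAlgHom k (lstrRel k q G) (x21 k))
    (fun t => RingQuot.mkAlgHom k (lstrRel k q G) (z k q t)) where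
  sq := by
    rw [← map_mul]
    exact mkAlgHom_eq_zero ⟨rfl, Or.inl rfl⟩
  y_eq := by simp only [x21, map_add, map_mul]
  x₂_y := by
    have := mkAlgHom_eq_zero (q := q) (G := G) (k := k) ⟨rfl, Or.inr (Or.inl rfl)⟩
    rw [map_sub, map_sub, map_mul, map_mul, map_mul, sub_sub, sub_eq_zero] at this
    exact this
  succ t := by simp only [z, map_sub, map_mul, map_smul]
  x₁_zero := by
    have := mkAlgHom_eq_zero (q := q) (G := G) (k := k) ⟨rfl, Or.inr (Or.inr (Or.inl rfl))⟩
    rw [map_sub, map_smul, map_mul, map_mul, sub_eq_zero] at this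
    exact this
  y_zero := by
    have := mkAlgHom_eq_zero (q := q) (G := G) (k := k)
      ⟨rfl, Or.inr (Or.inr (Or.inr (Or.inl rfl)))⟩
    rw [map_sub, map_smul, map_mul, map_mul, sub_eq_zero] at this
    exact this
  top := mkAlgHom_eq_zero ⟨rfl, Or.inr (Or.inr (Or.inr (Or.inr (Or.inl rfl))))⟩
  even_sq j hj := by
    rw [← map_mul]
    exact mkAlgHom_eq_zero ⟨rfl, Or.inr (Or.inr (Or.inr (Or.inr (Or.inr (Or.inl ⟨j, hj, rfl⟩)))))⟩
  adj j h1 hj := by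
    rw [← map_mul, ← map_mul, ← map_smul, ← map_add]
    exact mkAlgHom_eq_zero
      ⟨rfl, Or.inr (Or.inr (Or.inr (Or.inr (Or.inr (Or.inr ⟨j, h1, hj, rfl⟩)))))⟩

/-- The universal property of the presented algebra. -/
theorem IsLstr.exists_algHom {B : Type*} [Ring B] [Algebra k B] {x₁ x₂ y : B} {Z : ℕ → B}
    (h : IsLstr q G x₁ x₂ y Z) : ∃ φ : RingQuot (lstrRel k q G) →ₐ[k] B,
      φ (RingQuot.mkAlgHom k (lstrRel k q G) (X k 0)) = x₁ ∧
      φ (RingQuot.mkAlgHom k (lstrRel k q G) (X k 1)) = x₂ ∧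
      φ (RingQuot.mkAlgHom k (lstrRel k q G) (x21 k)) = y ∧
      ∀ t, φ (RingQuot.mkAlgHom k (lstrRel k q G) (z k q t)) = Z t := by
  let f : FreeAlgebra k (Fin 3) →ₐ[k] B := FreeAlgebra.lift k ![x₁, x₂, Z 0]
  have h0 : f (X k 0) = x₁ := by simp [f, X]
  have h1 : f (X k 1) = x₂ := by simp [f, X]
  have h2 : f (X k 2) = Z 0 := by simp [f, X]
  have hy : f (x21 k) = y := by rw [x21, map_add, map_mul, map_mul, h0, h1, h.y_eq]
  have hz : ∀ t, f (z k q t) = Z t := by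
    intro t
    induction t with
    | zero => exact h2
    | succ t ih => rw [z, map_sub, map_smul, map_mul, map_mul, ih, h1, h.succ]
  have hf : ∀ ⦃a b⦄, lstrRel k q G a b → f a = f b := by
    rintro a b ⟨rfl, hab⟩
    rw [map_zero]
    rcases hab with rfl | rfl | rfl | rfl | rfl | ⟨j, hj, rfl⟩ | ⟨j, hj1, hj, rfl⟩
    · rw [map_mul, h0, h.sq]
    · rw [map_sub, map_sub, map_mul, map_mul, map_mul, h0, h1, hy, h.x₂_y]
      abel
    · rw [map_sub, map_smul, map_mul, map_mul, h0, h2, h.x₁_zero, sub_self]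
    · rw [map_sub, map_smul, map_mul, map_mul, hy, h2, h.y_zero, sub_self]
    · rw [hz, h.top]
    · rw [map_mul, hz, h.even_sq j hj]
    · rw [map_add, map_smul, map_mul, map_mul, hz, hz, h.adj j hj1 hj]
  refine ⟨RingQuot.liftAlgHom k ⟨f, hf⟩, ?_, ?_, ?_, fun t => ?_⟩ <;>
    rw [RingQuot.liftAlgHom_mkAlgHom_apply]
  exacts [h0, h1, hy, hz t]

/-- The index set of the PBW basis. -/
abbrev PBWIndex (G : ℕ) : Type :=
  Fin 2 × ℕ × ℕ ×
    {n : Fin (2 * G + 1) → ℕ // ∀ t : Fin (2 * G + 1), (t : ℕ) % 2 = 0 → n t ≤ 1}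

/-- Extension of an exponent vector by zero. -/
def extendZero {m : ℕ} (n : Fin m → ℕ) (t : ℕ) : ℕ := if h : t < m then n ⟨t, h⟩ else 0

theorem extendZero_injective {m : ℕ} : Function.Injective (extendZero (m := m)) := by
  intro n n' h
  funext t
  simpa [extendZero] using congrFun h t

theorem PBWIndex.extendZero_le (p : PBWIndex G) (t : ℕ) (ht : Even t) :
    extendZero p.2.2.2.1 t ≤ 1 := by
  unfold extendZero
  split_ifs with h
  · exact p.2.2.2.2 ⟨t, h⟩ (Nat.even_iff.mp ht)
  · exact Nat.zero_le _

theorem bas_eq (p : PBWIndex G) : bas k q G p =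
    RingQuot.mkAlgHom k (lstrRel k q G) (X k 0) ^ (p.1 : ℕ) *
      RingQuot.mkAlgHom k (lstrRel k q G) (x21 k) ^ p.2.1 *
      RingQuot.mkAlgHom k (lstrRel k q G) (X k 1) ^ p.2.2.1 *
      zMon (fun t => RingQuot.mkAlgHom k (lstrRel k q G) (z k q t)) (2 * G + 1)
        (extendZero p.2.2.2.1) := by
  rw [bas, map_mul, map_mul, map_mul, map_pow, map_pow, map_pow, ← reverse_ofFn_prod,
    map_list_prod, List.map_reverse, List.map_ofFn]
  congr 4
  funext t
  rw [Function.comp_apply, map_pow, extendZero, dif_pos t.2]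

/-- A family is linearly independent if it is triangular for some functionals and a rank. -/
theorem linearIndependent_of_triangular {ι M : Type*} [AddCommGroup M] [Module k M] (v : ι → M)
    (r : ι → ℕ) (f : ι → M →ₗ[k] k) (hf : ∀ i, f i (v i) ≠ 0)
    (hf' : ∀ i j, j ≠ i → r j ≤ r i → f i (v j) = 0) : LinearIndependent k v := by
  classical
  rw [linearIndependent_iff']
  intro s g hg
  by_contra! hne
  obtain ⟨i, hi, hgi⟩ := hne
  obtain ⟨i₀, hi₀, hmax⟩ := (s.filter fun i => g i ≠ 0).exists_max_image r
    ⟨i, Finset.mem_filter.mpr ⟨hi, hgi⟩⟩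
  obtain ⟨hi₀s, hgi₀⟩ := Finset.mem_filter.mp hi₀
  have h := congrArg (f i₀) hg
  rw [map_sum, map_zero, Finset.sum_eq_single_of_mem i₀ hi₀s] at h
  · rw [map_smul, smul_eq_mul] at h
    exact mul_ne_zero hgi₀ (hf i₀) h
  · intro j hj hji
    rw [map_smul, smul_eq_mul]
    by_cases hgj : g j = 0
    · rw [hgj, zero_mul]
    · rw [hf' i₀ j hji (hmax j (Finset.mem_filter.mpr ⟨hj, hgj⟩)), mul_zero]

theorem linearIndependent_bas (hq : q ≠ 0) : LinearIndependent k (bas k q G) := by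
  obtain ⟨φ, h1, h2, hy, hz⟩ := (FockSpace.isLstr (G := G) hq).exists_algHom
  have hφ : ∀ p : PBWIndex G, φ (bas k q G p) =
      FockSpace.opX₁ G q ^ (p.1 : ℕ) * FockSpace.opX₂₁ G q ^ p.2.1 *
        FockSpace.opX₂ G q ^ p.2.2.1 *
        zMon (FockSpace.opZ G q) (2 * G + 1) (extendZero p.2.2.2.1) := by
    intro p
    rw [bas_eq, map_mul, map_mul, map_mul, map_pow, map_pow, map_pow, h1, h2, hy,
      ← reverse_ofFn_prod, ← reverse_ofFn_prod, map_list_prod, List.map_reverse, List.map_ofFn]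
    congr 4
    funext t
    simp [hz]
  let vac : FockSpace.FockRep k :=
    FockSpace.tmul k (Finsupp.single 0 1) (Finsupp.single (0, 0, 0) 1)
  let ev : RingQuot (lstrRel k q G) →ₗ[k] FockSpace.FockRep k :=
    (LinearMap.applyₗ vac).comp φ.toLinearMap
  have hev : ∀ a, ev a = φ a vac := fun a => rfl
  have hmon := fun p : PBWIndex G => FockSpace.monomial_vacuum (G := G) hq p.1 p.2.1 p.2.2.1
    (extendZero p.2.2.2.1) p.extendZero_le fun t ht => dif_neg (by omega)
  have hcoord : ∀ p p' : PBWIndex G, p'.2.2.1 ≤ p.2.2.1 → ∃ a : k, a ≠ 0 ∧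
      FockSpace.coord k (extendZero p.2.2.2.1) (p.1, p.2.1, p.2.2.1) (ev (bas k q G p')) =
        a * (Finsupp.single (extendZero p'.2.2.2.1) (1 : k) (extendZero p.2.2.2.1) *
          Finsupp.single (p'.1, p'.2.1, p'.2.2.1) (1 : k) (p.1, p.2.1, p.2.2.1)) := by
    intro p p' hpp
    obtain ⟨a, ha, hmem⟩ := hmon p'
    refine ⟨a, ha, ?_⟩
    have := FockSpace.coord_lowerTerms (extendZero p.2.2.2.1) (p.1, p.2.1, p.2.2.1) hpp hmem
    rw [map_sub, sub_eq_zero, map_smul, FockSpace.coord_tmul] at this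
    rw [hev, hφ, this, smul_eq_mul]
  refine LinearIndependent.of_comp ev (linearIndependent_of_triangular _ (fun p => p.2.2.1)
    (fun p => FockSpace.coord k (extendZero p.2.2.2.1) (p.1, p.2.1, p.2.2.1)) ?_ ?_)
  · intro p
    obtain ⟨a, ha, h⟩ := hcoord p p le_rfl
    rw [Function.comp_apply, h]
    simpa using ha
  · intro p p' hne hle
    obtain ⟨a, ha, h⟩ := hcoord p p' hle
    rw [Function.comp_apply, h]
    by_cases hn : extendZero p'.2.2.2.1 = extendZero p.2.2.2.1
    · rw [Finsupp.single_eq_of_ne (a := (p'.1, p'.2.1, p'.2.2.1)), mul_zero, mul_zero]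
      rintro heq
      refine hne ?_
      obtain ⟨i, b, c, n⟩ := p
      obtain ⟨i', b', c', n'⟩ := p'
      simp only [Prod.mk.injEq] at heq ⊢
      exact ⟨heq.1.symm, heq.2.1.symm, heq.2.2.symm, Subtype.ext (extendZero_injective hn)⟩
    · rw [Finsupp.single_eq_of_ne (Ne.symm hn), zero_mul, mul_zero]

end Presentation

section Growth

open Filter Topology

theorem tendsto_log_mul_pow_div_log {C : ℝ} (hC : 0 < C) (d : ℕ) :
    Tendsto (fun n : ℕ => ENNReal.ofReal (Real.log ((C * n) ^ d) / Real.log n)) atTop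
      (𝓝 (d : ℝ≥0∞)) := by
  have hlog : Tendsto (fun n : ℕ => Real.log (n : ℝ)) atTop atTop :=
    Real.tendsto_log_atTop.comp tendsto_natCast_atTop_atTop
  have h1 : Tendsto (fun n : ℕ => (d : ℝ) * (Real.log C / Real.log n + 1)) atTop (𝓝 d) := by
    have := ((hlog.const_div_atTop (Real.log C)).add_const 1).const_mul (d : ℝ)
    simpa using this
  have h2 : Tendsto (fun n : ℕ => Real.log ((C * n) ^ d) / Real.log n) atTop (𝓝 d) := by
    refine h1.congr' ?_
    filter_upwards [eventually_ge_atTop 2] with n hn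
    have hn' : (1 : ℝ) < n := by exact_mod_cast hn
    have hpos := Real.log_pos hn'
    rw [Real.log_pow, Real.log_mul hC.ne' (by positivity)]
    field_simp
  simpa using ENNReal.tendsto_ofReal h2

theorem limsup_log_div_log_le {f : ℕ → ℕ} {C : ℝ} (hC : 1 ≤ C) {d : ℕ}
    (h : ∀ᶠ n : ℕ in atTop, (f n : ℝ) ≤ (C * n) ^ d) :
    limsup (fun n : ℕ => ENNReal.ofReal (Real.log (f n) / Real.log n)) atTop ≤ d := by
  rw [← (tendsto_log_mul_pow_div_log (zero_lt_one.trans_le hC) d).limsup_eq]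
  refine limsup_le_limsup ?_
  filter_upwards [h, eventually_ge_atTop 1] with n hn h1
  have h1' : (1 : ℝ) ≤ n := by exact_mod_cast h1
  refine ENNReal.ofReal_le_ofReal (div_le_div_of_nonneg_right ?_ (Real.log_nonneg h1'))
  rcases Nat.eq_zero_or_pos (f n) with h0 | h0
  · rw [h0, Nat.cast_zero, Real.log_zero]
    exact Real.log_nonneg (one_le_pow₀ (one_le_mul_of_one_le_of_one_le hC h1'))
  · exact Real.log_le_log (by exact_mod_cast h0) hn

theorem le_limsup_log_div_log {f : ℕ → ℕ} {C : ℝ} (hC : 0 < C) {d : ℕ}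
    (h : ∀ᶠ n : ℕ in atTop, (C * n) ^ d ≤ (f n : ℝ)) :
    d ≤ limsup (fun n : ℕ => ENNReal.ofReal (Real.log (f n) / Real.log n)) atTop := by
  rw [← (tendsto_log_mul_pow_div_log hC d).limsup_eq]
  refine limsup_le_limsup ?_
  filter_upwards [h, eventually_ge_atTop 1] with n hn h1
  have h1' : (1 : ℝ) ≤ n := by exact_mod_cast h1
  refine ENNReal.ofReal_le_ofReal (div_le_div_of_nonneg_right ?_ (Real.log_nonneg h1'))
  exact Real.log_le_log (by positivity) hn

theorem Submodule.sum_le_of_forall_le {k A ι : Type*} [Semiring k] [AddCommMonoid A] [Module k A]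
    {s : Finset ι} {f : ι → Submodule k A} {W : Submodule k A} (h : ∀ i ∈ s, f i ≤ W) :
    ∑ i ∈ s, f i ≤ W :=
  Finset.sum_induction f (· ≤ W) (fun _ _ => sup_le) bot_le h

end Growth

section PBW

variable {k : Type*} [Field k] {q : k} {G : ℕ}

variable (k q G) in
/-- The filtration of the presented algebra by the length of PBW monomials. -/
noncomputable def lstrFilt (N : ℕ) : Submodule k (RingQuot (lstrRel k q G)) :=
  pbwFilt k G (RingQuot.mkAlgHom k (lstrRel k q G) (X k 0))
    (RingQuot.mkAlgHom k (lstrRel k q G) (X k 1)) (RingQuot.mkAlgHom k (lstrRel k q G) (x21 k))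
    (fun t => RingQuot.mkAlgHom k (lstrRel k q G) (z k q t)) N

theorem lstrFilt_mono : Monotone (lstrFilt k q G) := IsLstr.pbwFilt_mono

theorem one_mem_lstrFilt (N : ℕ) : 1 ∈ lstrFilt k q G N := IsLstr.one_mem_pbwFilt N

theorem mk_x₁_mem_lstrFilt : RingQuot.mkAlgHom k (lstrRel k q G) (X k 0) ∈ lstrFilt k q G 1 := by
  have := isLstr_mkAlgHom.x₁_mul_mem (one_mem_lstrFilt (k := k) (q := q) (G := G) 0)
  rw [mul_one] at this
  exact this

theorem mk_x₂_mem_lstrFilt : RingQuot.mkAlgHom k (lstrRel k q G) (X k 1) ∈ lstrFilt k q G 1 := by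
  have := isLstr_mkAlgHom.x₂_mul_mem (one_mem_lstrFilt (k := k) (q := q) (G := G) 0)
  rw [mul_one] at this
  exact this

theorem mk_x21_mem_lstrFilt : RingQuot.mkAlgHom k (lstrRel k q G) (x21 k) ∈ lstrFilt k q G 1 := by
  have := isLstr_mkAlgHom.y_mul_mem (one_mem_lstrFilt (k := k) (q := q) (G := G) 0)
  rw [mul_one] at this
  exact this

theorem mk_z_mem_lstrFilt [CharZero k] (hq : q ≠ 0) (t : ℕ) :
    RingQuot.mkAlgHom k (lstrRel k q G) (z k q t) ∈ lstrFilt k q G 1 := by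
  have := isLstr_mkAlgHom.Z_mul_mem hq t (one_mem_lstrFilt (k := k) (q := q) (G := G) 0)
  rw [mul_one] at this
  exact this

theorem mul_mem_lstrFilt [CharZero k] (hq : q ≠ 0) {M N : ℕ} {v w : RingQuot (lstrRel k q G)}
    (hv : v ∈ lstrFilt k q G M) (hw : w ∈ lstrFilt k q G N) : v * w ∈ lstrFilt k q G (M + N) :=
  isLstr_mkAlgHom.pbwFilt_mul_mem hq hv hw

theorem exists_mem_lstrFilt [CharZero k] (hq : q ≠ 0) (a : RingQuot (lstrRel k q G)) :
    ∃ N, a ∈ lstrFilt k q G N := by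
  obtain ⟨a, rfl⟩ := RingQuot.mkAlgHom_surjective k (lstrRel k q G) a
  induction a using FreeAlgebra.induction with
  | grade0 r =>
    refine ⟨0, ?_⟩
    rw [AlgHom.commutes, Algebra.algebraMap_eq_smul_one]
    exact Submodule.smul_mem _ _ (one_mem_lstrFilt 0)
  | grade1 i =>
    refine ⟨1, ?_⟩
    fin_cases i
    exacts [mk_x₁_mem_lstrFilt, mk_x₂_mem_lstrFilt, mk_z_mem_lstrFilt hq 0]
  | mul a b ha hb =>
    obtain ⟨M, hM⟩ := ha
    obtain ⟨N, hN⟩ := hb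
    rw [map_mul]
    exact ⟨M + N, mul_mem_lstrFilt hq hM hN⟩
  | add a b ha hb =>
    obtain ⟨M, hM⟩ := ha
    obtain ⟨N, hN⟩ := hb
    rw [map_add]
    exact ⟨M + N, add_mem (lstrFilt_mono (by omega) hM) (lstrFilt_mono (by omega) hN)⟩

/-- The exponents of PBW monomials bounded by `N`. -/
abbrev PBWBox (G N : ℕ) : Type :=
  (Fin 2 × Fin (N + 1) × Fin (N + 1)) × (Fin (G + 1) → Fin 2) × (Fin G → Fin (N + 1))

theorem card_PBWBox (G N : ℕ) : Fintype.card (PBWBox G N) = (2 * (N + 1)) ^ (G + 2) := by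
  simp only [Fintype.card_prod, Fintype.card_fun, Fintype.card_fin, mul_pow]
  ring

/-- The PBW index with the given exponents. -/
def PBWBox.toIndex {N : ℕ} (p : PBWBox G N) : PBWIndex G :=
  ⟨p.1.1, p.1.2.1, p.1.2.2, fun t => if h : (t : ℕ) % 2 = 0 then (p.2.1 ⟨t / 2, by omega⟩ : ℕ)
    else p.2.2 ⟨t / 2, by omega⟩, fun t ht => by
      dsimp only
      rw [dif_pos ht]
      exact Nat.le_of_lt_succ (Fin.is_lt _)⟩

theorem PBWBox.extendZero_even {N : ℕ} (p : PBWBox G N) (j : Fin (G + 1)) :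
    extendZero p.toIndex.2.2.2.1 (2 * j) = p.2.1 j := by
  rw [extendZero, dif_pos (by omega)]
  simp [toIndex]

theorem PBWBox.extendZero_odd {N : ℕ} (p : PBWBox G N) (j : Fin G) :
    extendZero p.toIndex.2.2.2.1 (2 * j + 1) = p.2.2 j := by
  rw [extendZero, dif_pos (by omega)]
  have : (2 * (j : ℕ) + 1) / 2 = j := by omega
  simp [toIndex, this, Nat.add_mod]

theorem PBWBox.toIndex_injective {N : ℕ} : Function.Injective (PBWBox.toIndex (G := G) (N := N)) := by
  intro p p' h
  have h1 : p.1 = p'.1 := by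
    refine Prod.ext (congrArg (fun x : PBWIndex G => x.1) h) (Prod.ext (Fin.ext ?_) (Fin.ext ?_))
    · exact congrArg (fun x : PBWIndex G => x.2.1) h
    · exact congrArg (fun x : PBWIndex G => x.2.2.1) h
  refine Prod.ext h1 (Prod.ext (funext fun j => Fin.ext ?_) (funext fun j => Fin.ext ?_))
  · rw [← p.extendZero_even, ← p'.extendZero_even, h]
  · rw [← p.extendZero_odd, ← p'.extendZero_odd, h]

theorem lstrFilt_le_span (N : ℕ) : lstrFilt k q G N ≤
    Submodule.span k (Set.range fun p : PBWBox G N => bas k q G p.toIndex) := by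
  refine Submodule.span_le.mpr ?_
  rintro _ ⟨i, b, c, n, hi, hn, hN, rfl⟩
  have hle : ∀ t < 2 * G + 1, n t ≤ N := fun t ht =>
    (Finset.single_le_sum (fun _ _ => Nat.zero_le _) (Finset.mem_range.mpr ht)).trans
      ((Nat.le_add_left _ _).trans hN)
  let p : PBWBox G N := ((⟨i, by omega⟩, ⟨b, by omega⟩, ⟨c, by omega⟩),
    fun j => ⟨n (2 * j), Nat.lt_succ_of_le (hn _ (even_two_mul _))⟩,
    fun j => ⟨n (2 * j + 1), Nat.lt_succ_of_le (hle _ (by omega))⟩)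
  refine Submodule.subset_span ⟨p, ?_⟩
  change bas k q G p.toIndex = _
  rw [bas_eq]
  congr 1
  refine zMon_congr _ fun t ht => ?_
  rcases Nat.even_or_odd' t with ⟨j, rfl | rfl⟩
  · exact p.extendZero_even ⟨j, by omega⟩
  · exact p.extendZero_odd ⟨j, by omega⟩

theorem span_bas [CharZero k] (hq : q ≠ 0) : Submodule.span k (Set.range (bas k q G)) = ⊤ := by
  rw [eq_top_iff]
  intro a _
  obtain ⟨N, hN⟩ := exists_mem_lstrFilt hq a
  refine Submodule.span_mono ?_ (lstrFilt_le_span N hN)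
  rintro _ ⟨p, rfl⟩
  exact ⟨p.toIndex, rfl⟩

theorem finiteDimensional_lstrFilt (N : ℕ) : FiniteDimensional k (lstrFilt k q G N) := by
  have := FiniteDimensional.span_of_finite k
    (Set.finite_range fun p : PBWBox G N => bas k q G p.toIndex)
  exact Submodule.finiteDimensional_of_le (lstrFilt_le_span N)

theorem finrank_lstrFilt_le (N : ℕ) :
    Module.finrank k (lstrFilt k q G N) ≤ (2 * (N + 1)) ^ (G + 2) := by
  have := FiniteDimensional.span_of_finite k
    (Set.finite_range fun p : PBWBox G N => bas k q G p.toIndex)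
  exact (Submodule.finrank_mono (lstrFilt_le_span N)).trans
    ((finrank_range_le_card _).trans_eq (card_PBWBox G N))

theorem sum_pow_le_lstrFilt [CharZero k] (hq : q ≠ 0) {V : Submodule k (RingQuot (lstrRel k q G))}
    {m : ℕ} (hV : V ≤ lstrFilt k q G m) (n : ℕ) :
    ∑ j ∈ Finset.range (n + 1), V ^ j ≤ lstrFilt k q G (m * n) := by
  refine Submodule.sum_le_of_forall_le fun j hj => ?_
  exact (pow_le_pow_left' hV j).trans ((isLstr_mkAlgHom.pow_pbwFilt_le hq m j).trans
    (lstrFilt_mono (Nat.mul_le_mul_left m (by simpa [Nat.lt_succ_iff] using hj))))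

theorem exists_le_lstrFilt [CharZero k] (hq : q ≠ 0) (V : Submodule k (RingQuot (lstrRel k q G)))
    [FiniteDimensional k V] : ∃ m, V ≤ lstrFilt k q G m := by
  obtain ⟨S, hS⟩ := (Submodule.fg_iff_finiteDimensional V).mpr inferInstance
  choose N hN using exists_mem_lstrFilt (k := k) (q := q) (G := G) hq
  refine ⟨S.sup N, hS ▸ Submodule.span_le.mpr fun a ha => ?_⟩
  exact lstrFilt_mono (Finset.le_sup ha) (hN a)

theorem bas_mem_pow [CharZero k] (hq : q ≠ 0) (p : PBWIndex G) : bas k q G p ∈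
    lstrFilt k q G 1 ^ ((p.1 : ℕ) + p.2.1 + p.2.2.1 +
      ∑ t ∈ Finset.range (2 * G + 1), extendZero p.2.2.2.1 t) := by
  rw [bas_eq, pow_add, pow_add, pow_add]
  exact Submodule.mul_mem_mul (Submodule.mul_mem_mul (Submodule.mul_mem_mul
    (Submodule.pow_mem_pow _ mk_x₁_mem_lstrFilt _) (Submodule.pow_mem_pow _ mk_x21_mem_lstrFilt _))
    (Submodule.pow_mem_pow _ mk_x₂_mem_lstrFilt _))
    (zMon_mem_pow (fun t _ => mk_z_mem_lstrFilt hq t) _)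

theorem PBWBox.length_le {N : ℕ} (p : PBWBox G N) :
    (p.toIndex.1 : ℕ) + p.toIndex.2.1 + p.toIndex.2.2.1 +
      ∑ t ∈ Finset.range (2 * G + 1), extendZero p.toIndex.2.2.2.1 t ≤ (G + 2) * (N + 1) := by
  have hsum : ∀ m ≤ G, ∑ t ∈ Finset.range (2 * m + 1), extendZero p.toIndex.2.2.2.1 t ≤
      m * (N + 1) + 1 := by
    intro m hm
    induction m with
    | zero =>
      have := p.extendZero_even 0
      have h2 := (p.2.1 0).is_lt
      simp at this ⊢
      omega
    | succ m ih =>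
      have h0 := ih (by omega)
      have h1 := p.extendZero_odd ⟨m, by omega⟩
      have h2 : extendZero p.toIndex.2.2.2.1 (2 * m + 1 + 1) = p.2.1 ⟨m + 1, by omega⟩ :=
        p.extendZero_even ⟨m + 1, by omega⟩
      have h3 := (p.2.2 ⟨m, by omega⟩).is_lt
      have h4 := (p.2.1 ⟨m + 1, by omega⟩).is_lt
      have e : 2 * (m + 1) + 1 = 2 * m + 1 + 1 + 1 := by ring
      rw [e, Finset.sum_range_succ, Finset.sum_range_succ, add_mul, h1, h2]
      omega
  have h := hsum G le_rfl
  have h1 := p.1.1.is_lt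
  have h2 := p.1.2.1.is_lt
  have h3 := p.1.2.2.is_lt
  change (p.1.1 : ℕ) + p.1.2.1 + p.1.2.2 + _ ≤ _
  rw [add_mul]
  omega

theorem le_finrank_sum_pow [CharZero k] (hq : q ≠ 0) {N n : ℕ} (hn : (G + 2) * (N + 1) ≤ n) :
    (2 * (N + 1)) ^ (G + 2) ≤
      Module.finrank k ↥(∑ j ∈ Finset.range (n + 1), lstrFilt k q G 1 ^ j) := by
  have := finiteDimensional_lstrFilt (k := k) (q := q) (G := G) (1 * n)
  have := Submodule.finiteDimensional_of_le
    (sum_pow_le_lstrFilt (q := q) (G := G) hq (le_refl (lstrFilt k q G 1)) n)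
  have hli : LinearIndependent k fun p : PBWBox G N => bas k q G p.toIndex :=
    (linearIndependent_bas hq).comp _ PBWBox.toIndex_injective
  rw [← card_PBWBox, ← finrank_span_eq_card hli]
  refine Submodule.finrank_mono (Submodule.span_le.mpr ?_)
  rintro _ ⟨p, rfl⟩
  have hj := Finset.mem_range.mpr (Nat.lt_succ_of_le (p.length_le.trans hn))
  have hle := Finset.single_le_sum (f := fun j => lstrFilt k q G 1 ^ j)
    (fun _ _ => bot_le) hj
  exact hle (bas_mem_pow hq p.toIndex)

theorem GKdim_eq [CharZero k] (hq : q ≠ 0) :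
    GKdim k (RingQuot (lstrRel k q G)) = (G : ℝ≥0∞) + 2 := by
  have hG : ((G + 2 : ℕ) : ℝ≥0∞) = (G : ℝ≥0∞) + 2 := by push_cast; rfl
  rw [← hG]
  refine le_antisymm (iSup₂_le fun V hV => ?_)
    (le_iSup₂_of_le (lstrFilt k q G 1) (finiteDimensional_lstrFilt 1) ?_)
  · obtain ⟨m, hm⟩ := exists_le_lstrFilt hq V
    refine limsup_log_div_log_le (C := 2 * (m + 1)) (by linarith [m.cast_nonneg (α := ℝ)]) ?_
    filter_upwards [Filter.eventually_ge_atTop 1] with n hn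
    have := finiteDimensional_lstrFilt (k := k) (q := q) (G := G) (m * n)
    have h1 := (Submodule.finrank_mono (sum_pow_le_lstrFilt hq hm n)).trans (finrank_lstrFilt_le _)
    have h2 : 2 * (m * n + 1) ≤ 2 * (m + 1) * n := by nlinarith
    exact_mod_cast h1.trans (Nat.pow_le_pow_left h2 _)
  · refine le_limsup_log_div_log (C := ((G + 2 : ℕ) : ℝ)⁻¹) (by positivity) ?_
    filter_upwards [Filter.eventually_ge_atTop (G + 2)] with n hn
    obtain ⟨N, hN⟩ := Nat.exists_eq_add_of_le' (Nat.div_pos hn (by omega))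
    have hle : (G + 2) * (N + 1) ≤ n := hN ▸ Nat.mul_div_le n (G + 2)
    have hlt : n < (G + 2) * (N + 1 + 1) := hN ▸ Nat.lt_mul_div_succ n (by omega)
    have h1 : (((2 * (N + 1)) ^ (G + 2) : ℕ) : ℝ) ≤ _ :=
      Nat.cast_le.mpr (le_finrank_sum_pow (k := k) (q := q) hq hle)
    refine le_trans ?_ h1
    have h2 : n ≤ (G + 2) * (2 * (N + 1)) := hlt.le.trans (Nat.mul_le_mul_left _ (by omega))
    have h3 : (n : ℝ) ≤ ((G + 2 : ℕ) : ℝ) * ((2 * (N + 1) : ℕ) : ℝ) := by exact_mod_cast h2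
    rw [Nat.cast_pow]
    refine pow_le_pow_left₀ (by positivity) ?_ _
    rw [inv_mul_le_iff₀ (by positivity)]
    exact h3

end PBW

/-- The PBW monomials form a basis of `B(lstr₋(−1,G))`, and
`GKdim B(lstr₋(−1,G)) = G + 2`. -/
theorem statement12 (k : Type*) [Field k] [IsAlgClosed k] [CharZero k]
    (q : k) (hq : q ≠ 0) (G : ℕ) (hG : 1 ≤ G) :
    (LinearIndependent k (bas k q G) ∧
      Submodule.span k (Set.range (bas k q G)) = ⊤) ∧
    GKdim k (RingQuot (lstrRel k q G)) = (G : ℝ≥0∞) + 2 := by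
  exact ⟨⟨linearIndependent_bas hq, span_bas hq⟩, GKdim_eq hq⟩
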